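/- arXiv:2102.08105 — 10 statements merged into one kernel-verified Lean document; each statement's English description precedes it below -/
import Mathlib

section
/- Let δ > 0 and α > 0. The function g : ℝ³ → ℝ defined by g(v₂, v₃, v₅) = (α/2)·[ (v₅ − √(v₂² + v₃² + δ²))² + (√2 − 1)·v₅² + (1/δ)·(v₂² + v₃²) ] is convex on the convex set { (v₂, v₃, v₅) ∈ ℝ³ : 0 < v₅ < 1 }. -/
/-- The regularized norm `√(x² + y² + δ²)` is nonexpansive. -/
theorem sq_sqrt_sub_sqrt_le (δ x y x' y' : ℝ) :
    (Real.sqrt (x ^ 2 + y ^ 2 + δ ^ 2) - Real.sqrt (x' ^ 2 + y' ^ 2 + δ ^ 2)) ^ 2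
      ≤ (x - x') ^ 2 + (y - y') ^ 2 := by
  have h₁ : Real.sqrt (x ^ 2 + y ^ 2 + δ ^ 2) ^ 2 = x ^ 2 + y ^ 2 + δ ^ 2 :=
    Real.sq_sqrt (by positivity)
  have h₂ : Real.sqrt (x' ^ 2 + y' ^ 2 + δ ^ 2) ^ 2 = x' ^ 2 + y' ^ 2 + δ ^ 2 :=
    Real.sq_sqrt (by positivity)
  have h₃ : x * x' + y * y' + δ ^ 2 ≤
      Real.sqrt (x ^ 2 + y ^ 2 + δ ^ 2) * Real.sqrt (x' ^ 2 + y' ^ 2 + δ ^ 2) := by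
    refine le_of_sq_le_sq ?_ (by positivity)
    rw [mul_pow, h₁, h₂]
    nlinarith [sq_nonneg (x * y' - y * x'), sq_nonneg (x * δ - δ * x'),
      sq_nonneg (y * δ - δ * y')]
  nlinarith

/-- The convexity defect of the regularized norm `√(x² + y² + δ²)` is at most that of
`(x² + y²) / (2δ)`. -/
theorem sqrt_convexity_defect_le {δ a b : ℝ} (hδ : 0 < δ) (ha : 0 ≤ a) (hb : 0 ≤ b)
    (hab : a + b = 1) (x y x' y' : ℝ) :
    a * Real.sqrt (x ^ 2 + y ^ 2 + δ ^ 2) + b * Real.sqrt (x' ^ 2 + y' ^ 2 + δ ^ 2)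
        - Real.sqrt ((a * x + b * x') ^ 2 + (a * y + b * y') ^ 2 + δ ^ 2)
      ≤ a * b * ((x - x') ^ 2 + (y - y') ^ 2) / (2 * δ) := by
  have key (u v : ℝ) : Real.sqrt (u ^ 2 + v ^ 2 + δ ^ 2) ^ 2 = u ^ 2 + v ^ 2 + δ ^ 2 ∧
      δ ≤ Real.sqrt (u ^ 2 + v ^ 2 + δ ^ 2) :=
    ⟨Real.sq_sqrt (by positivity), Real.le_sqrt_of_sq_le (by nlinarith [sq_nonneg u, sq_nonneg v])⟩
  obtain ⟨h₁, l₁⟩ := key x y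
  obtain ⟨h₂, l₂⟩ := key x' y'
  obtain ⟨h₃, l₃⟩ := key (a * x + b * x') (a * y + b * y')
  set s := Real.sqrt (x ^ 2 + y ^ 2 + δ ^ 2)
  set t := Real.sqrt (x' ^ 2 + y' ^ 2 + δ ^ 2)
  set m := Real.sqrt ((a * x + b * x') ^ 2 + (a * y + b * y') ^ 2 + δ ^ 2)
  obtain rfl : b = 1 - a := by linarith
  have hK : 0 ≤ a * (1 - a) * ((x - x') ^ 2 + (y - y') ^ 2) := by positivity
  have hA : δ ≤ a * s + (1 - a) * t := by nlinarith
  have hsq : (a * s + (1 - a) * t - m) * (a * s + (1 - a) * t + m)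
      ≤ a * (1 - a) * ((x - x') ^ 2 + (y - y') ^ 2) := by
    have e : (a * s + (1 - a) * t - m) * (a * s + (1 - a) * t + m)
        = a * s ^ 2 + (1 - a) * t ^ 2 - m ^ 2 - a * (1 - a) * (s - t) ^ 2 := by ring
    have h : 0 ≤ a * (1 - a) * (s - t) ^ 2 := by positivity
    rw [e, h₁, h₂, h₃]
    linarith
  rw [le_div_iff₀ (by positivity)]
  rcases le_total (a * s + (1 - a) * t - m) 0 with hS | hS <;> nlinarith

/-- convexity of the coupled part `e_{c₂}` of the convex splitting
of the binary fluid-surfactant free energy, as a function of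
`(v₂, v₃, v₅) ∈ ℝ³` on the convex set `{0 < v₅ < 1}`. -/
theorem coupled_part_convex (δ α : ℝ) (hδ : 0 < δ) (hα : 0 < α) :
    ConvexOn ℝ {v : ℝ × ℝ × ℝ | 0 < v.2.2 ∧ v.2.2 < 1}
      (fun v : ℝ × ℝ × ℝ =>
        (α / 2) * ((v.2.2 - Real.sqrt (v.1 ^ 2 + v.2.1 ^ 2 + δ ^ 2)) ^ 2
          + (Real.sqrt 2 - 1) * v.2.2 ^ 2 + (1 / δ) * (v.1 ^ 2 + v.2.1 ^ 2))) := by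
  have hconv : Convex ℝ {v : ℝ × ℝ × ℝ | 0 < v.2.2 ∧ v.2.2 < 1} :=
    (convex_Ioo (0 : ℝ) 1).linear_preimage
      ((LinearMap.snd ℝ ℝ ℝ).comp (LinearMap.snd ℝ ℝ (ℝ × ℝ)))
  refine ⟨hconv, ?_⟩
  rintro ⟨x, y, r⟩ hv ⟨x', y', r'⟩ hw a b ha hb hab
  obtain ⟨hm₀, hm₁⟩ := hconv hv hw ha hb hab
  simp only [Prod.smul_mk, Prod.mk_add_mk, smul_eq_mul] at hm₀ hm₁ ⊢
  have hlip := sq_sqrt_sub_sqrt_le δ x y x' y'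
  have hdef := sqrt_convexity_defect_le hδ ha hb hab x y x' y'
  have key (u v : ℝ) : Real.sqrt (u ^ 2 + v ^ 2 + δ ^ 2) ^ 2 = u ^ 2 + v ^ 2 + δ ^ 2 :=
    Real.sq_sqrt (by positivity)
  have h₁ := key x y
  have h₂ := key x' y'
  have h₃ := key (a * x + b * x') (a * y + b * y')
  set s := Real.sqrt (x ^ 2 + y ^ 2 + δ ^ 2)
  set t := Real.sqrt (x' ^ 2 + y' ^ 2 + δ ^ 2)
  set m := Real.sqrt ((a * x + b * x') ^ 2 + (a * y + b * y') ^ 2 + δ ^ 2)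
  have hc : 1 ≤ Real.sqrt 2 := Real.one_le_sqrt.2 (by norm_num)
  set c := Real.sqrt 2
  obtain rfl : b = 1 - a := by linarith
  set D := (x - x') ^ 2 + (y - y') ^ 2 with hD
  have hK : 0 ≤ a * (1 - a) * D / (2 * δ) := by positivity
  have hmS : (a * r + (1 - a) * r') * (a * s + (1 - a) * t - m) ≤ a * (1 - a) * D / (2 * δ) :=
    (mul_le_mul_of_nonneg_left hdef hm₀.le).trans (mul_le_of_le_one_left hK hm₁.le)
  have hδ' : a * (1 - a) * D / (2 * δ) = 1 / δ * (a * (1 - a) * D) / 2 := by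
    field_simp
  have hquad : 0 ≤ a * (1 - a) * (c * (r - r') ^ 2 + D - 2 * (r - r') * (s - t)) := by
    apply mul_nonneg (mul_nonneg ha hb)
    nlinarith [sq_nonneg (r - r' - (s - t)), mul_nonneg (sub_nonneg.2 hc) (sq_nonneg (r - r'))]
  have expand (u v w q : ℝ) (h : q ^ 2 = u ^ 2 + v ^ 2 + δ ^ 2) :
      (w - q) ^ 2 + (c - 1) * w ^ 2 + 1 / δ * (u ^ 2 + v ^ 2)
        = c * w ^ 2 - 2 * w * q + (1 + 1 / δ) * (u ^ 2 + v ^ 2) + δ ^ 2 := by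
    linear_combination h
  rw [expand _ _ _ _ h₁, expand _ _ _ _ h₂, expand _ _ _ _ h₃]
  rw [hδ'] at hmS
  have main : c * (a * r + (1 - a) * r') ^ 2 - 2 * (a * r + (1 - a) * r') * m
        + (1 + 1 / δ) * ((a * x + (1 - a) * x') ^ 2 + (a * y + (1 - a) * y') ^ 2) + δ ^ 2
      ≤ a * (c * r ^ 2 - 2 * r * s + (1 + 1 / δ) * (x ^ 2 + y ^ 2) + δ ^ 2)
        + (1 - a) * (c * r' ^ 2 - 2 * r' * t + (1 + 1 / δ) * (x' ^ 2 + y' ^ 2) + δ ^ 2) := by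
    rw [hD] at hmS hquad
    linear_combination hquad + 2 * hmS
  linear_combination α / 2 * main
end

section
/- Let δ > 0, α > 0, v₂, v₃ ∈ ℝ and v₅ ∈ (0,1), and set r = √(v₂² + v₃² + δ²). Then the symmetric 3×3 real matrix H = α · [ [√2, −v₂/r, −v₃/r], [−v₂/r, 1/δ + 1 − v₅(v₃² + δ²)/r³, v₂v₃v₅/r³], [−v₃/r, v₂v₃v₅/r³, 1/δ + 1 − v₅(v₂² + δ²)/r³] ] is positive semidefinite. -/
/-- A rank-one perturbation of a scalar block, bordered by the direction `(a, b)` of the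
perturbation, has a nonnegative quadratic form when the scalars dominate. -/
lemma bordered_quadratic_form_nonneg {t k q a b : ℝ} (ht : 1 ≤ t) (hq : 0 ≤ q) (hk : q + 1 ≤ k)
    (hab : a ^ 2 + b ^ 2 ≤ 1) (x y z : ℝ) :
    0 ≤ t * x ^ 2 - 2 * x * (a * y + b * z) + (k - q) * (y ^ 2 + z ^ 2)
      + q * (a * y + b * z) ^ 2 := by
  have cauchy : (a * y + b * z) ^ 2 ≤ y ^ 2 + z ^ 2 := by
    nlinarith [sq_nonneg (a * z - b * y),
      mul_nonneg (sub_nonneg.2 hab) (add_nonneg (sq_nonneg y) (sq_nonneg z))]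
  have hyz : 0 ≤ (k - q - 1) * (y ^ 2 + z ^ 2) :=
    mul_nonneg (by linarith) (by positivity)
  have hx : 0 ≤ (t - 1) * x ^ 2 := mul_nonneg (by linarith) (sq_nonneg x)
  have hs : 0 ≤ q * (a * y + b * z) ^ 2 := by positivity
  nlinarith [sq_nonneg (x - (a * y + b * z))]

/-- the Hessian matrix of the coupled energy density
`(v₂, v₃, v₅) ↦ (α/2)·[(v₅ − √(v₂² + v₃² + δ²))² + (√2 − 1)v₅² + (1/δ)(v₂² + v₃²)]`
is positive semidefinite for `δ > 0`, `α > 0`, `v₅ ∈ (0,1)`. -/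
theorem hessian_posSemidef (δ α v₂ v₃ v₅ r : ℝ) (hδ : 0 < δ) (hα : 0 < α)
    (hv₅0 : 0 < v₅) (hv₅1 : v₅ < 1)
    (hr : r = Real.sqrt (v₂ ^ 2 + v₃ ^ 2 + δ ^ 2)) :
    (α • Matrix.of
      ![![Real.sqrt 2, -v₂ / r, -v₃ / r],
        ![-v₂ / r, 1 / δ + 1 - v₅ * (v₃ ^ 2 + δ ^ 2) / r ^ 3, v₂ * v₃ * v₅ / r ^ 3],
        ![-v₃ / r, v₂ * v₃ * v₅ / r ^ 3,
          1 / δ + 1 - v₅ * (v₂ ^ 2 + δ ^ 2) / r ^ 3]] : Matrix (Fin 3) (Fin 3) ℝ).PosSemidef := by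
  have hr0 : 0 < r := hr ▸ Real.sqrt_pos.2 (by positivity)
  have hr2 : r ^ 2 = v₂ ^ 2 + v₃ ^ 2 + δ ^ 2 := by
    rw [hr, Real.sq_sqrt (by positivity)]
  have hδr : δ ≤ r := by
    rw [hr]
    exact Real.le_sqrt_of_sq_le (by nlinarith [sq_nonneg v₂, sq_nonneg v₃])
  have hq : v₅ / r ≤ 1 / δ := div_le_div₀ zero_le_one hv₅1.le hδ hδr
  have hab : (v₂ / r) ^ 2 + (v₃ / r) ^ 2 ≤ 1 := by
    rw [div_pow, div_pow, ← add_div, div_le_one (by positivity)]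
    nlinarith [sq_nonneg δ]
  have entry (u v : ℝ) (huv : r ^ 2 = u ^ 2 + v) :
      v₅ * v / r ^ 3 = v₅ / r - v₅ / r * (u / r) ^ 2 := by
    obtain rfl : v = r ^ 2 - u ^ 2 := by linarith
    field_simp
  have hcross : v₂ * v₃ * v₅ / r ^ 3 = v₅ / r * (v₂ / r) * (v₃ / r) := by
    field_simp
  rw [entry v₂ (v₃ ^ 2 + δ ^ 2) (by linarith), entry v₃ (v₂ ^ 2 + δ ^ 2) (by linarith),
    hcross, neg_div, neg_div]
  refine Matrix.PosSemidef.smul (.of_dotProduct_mulVec_nonneg ?_ fun x => ?_) hα.le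
  · ext i j
    fin_cases i <;> fin_cases j <;> simp
  · refine (bordered_quadratic_form_nonneg (Real.one_le_sqrt.2 one_le_two)
      (div_nonneg hv₅0.le hr0.le) (show v₅ / r + 1 ≤ 1 / δ + 1 by linarith) hab
      (x 0) (x 1) (x 2)).trans_eq ?_
    simp [dotProduct, Matrix.mulVec, Fin.sum_univ_three]
    ring
end

section
/- Let ε, η, ξ, α, β, δ > 0. Define, for v = (v₁, v₂, v₃, v₄, v₅, v₆, v₇) ∈ ℝ⁷ with 0 < v₅ < 1, with H(s) = s·ln s + (1−s)·ln(1−s): e_c(v) = (1/(4ε))·(v₁ − 1/2)⁴ + 1/(64ε) + (ε/2)·(v₂² + v₃²) + (η²/2)·v₄² + β·H(v₅) + (ξ/2)·(v₆² + v₇²) + (α/2)·[ (v₅ − √(v₂² + v₃² + δ²))² + (√2 − 1)·v₅² + (1/δ)·(v₂² + v₃²) ], and e_e(v) = (1/(8ε))·(v₁ − 1/2)² + (α/2)·[ (√2 − 1)·v₅² + (1/δ)·(v₂² + v₃²) ]. Then: (i) e_c is convex on the convex set { v ∈ ℝ⁷ : 0 < v₅ < 1 }; (ii) e_e is convex on ℝ⁷;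 and (iii) for every v with 0 < v₅ < 1, e_c(v) − e_e(v) = (1/(4ε))·v₁²(1 − v₁)² + (ε/2)·(v₂² + v₃²) + (η²/2)·v₄² + (ξ/2)·(v₆² + v₇²) + (α/2)·(v₅ − √(v₂² + v₃² + δ²))² + β·H(v₅). -/
noncomputable section

/-- Flory–Huggins entropy density `H(s) = s ln s + (1−s) ln(1−s)`. -/
def FH (s : ℝ) : ℝ := s * Real.log s + (1 - s) * Real.log (1 - s)

/-- The convex part `e_c` of the energy density, `v = (v₁,…,v₇) ∈ ℝ⁷`
(indices `v 0, …, v 6`). -/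
def ec (ε η ξ α β δ : ℝ) (v : Fin 7 → ℝ) : ℝ :=
  (1 / (4 * ε)) * (v 0 - 1 / 2) ^ 4 + 1 / (64 * ε)
    + (ε / 2) * ((v 1) ^ 2 + (v 2) ^ 2) + (η ^ 2 / 2) * (v 3) ^ 2
    + β * FH (v 4) + (ξ / 2) * ((v 5) ^ 2 + (v 6) ^ 2)
    + (α / 2) * ((v 4 - Real.sqrt ((v 1) ^ 2 + (v 2) ^ 2 + δ ^ 2)) ^ 2
        + (Real.sqrt 2 - 1) * (v 4) ^ 2 + (1 / δ) * ((v 1) ^ 2 + (v 2) ^ 2))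

/-- The concave part `e_e` of the energy density. -/
def ee (ε α δ : ℝ) (v : Fin 7 → ℝ) : ℝ :=
  (1 / (8 * ε)) * (v 0 - 1 / 2) ^ 2
    + (α / 2) * ((Real.sqrt 2 - 1) * (v 4) ^ 2 + (1 / δ) * ((v 1) ^ 2 + (v 2) ^ 2))

theorem convexOn_FH : ConvexOn ℝ (Set.Icc 0 1) FH := by
  have h := Real.strictConcave_binEntropy.concaveOn.neg
  refine h.congr fun x _ => ?_
  simp only [Pi.neg_apply, Real.binEntropy, FH, Real.log_inv]
  ring

theorem convexOn_even_pow_coord_sub {ι : Type*} {n : ℕ} (hn : Even n) (i : ι) (c : ℝ) :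
    ConvexOn ℝ Set.univ (fun v : ι → ℝ => (v i - c) ^ n) := by
  refine ⟨convex_univ, fun x _ y _ a b ha hb hab => ?_⟩
  have h := hn.convexOn_pow.2 (Set.mem_univ (x i - c)) (Set.mem_univ (y i - c)) ha hb hab
  have e : a * (x i - c) + b * (y i - c) = a * x i + b * y i - c := by
    linear_combination -c * hab
  simpa [smul_eq_mul, e] using h

theorem convexOn_coord_sq {ι : Type*} (i : ι) :
    ConvexOn ℝ Set.univ (fun v : ι → ℝ => v i ^ 2) := by
  simpa using convexOn_even_pow_coord_sub even_two i 0

/-- `p ↦ √(|p|² + δ²)` is 1-Lipschitz on the plane. -/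
theorem sq_sqrt_sub_sqrt_le_s2 (p q p' q' δ : ℝ) :
    (√(p ^ 2 + q ^ 2 + δ ^ 2) - √(p' ^ 2 + q' ^ 2 + δ ^ 2)) ^ 2
      ≤ (p - p') ^ 2 + (q - q') ^ 2 := by
  have hs := Real.sq_sqrt (show 0 ≤ p ^ 2 + q ^ 2 + δ ^ 2 by positivity)
  have hs' := Real.sq_sqrt (show 0 ≤ p' ^ 2 + q' ^ 2 + δ ^ 2 by positivity)
  have h : p * p' + q * q' + δ ^ 2 ≤ √(p ^ 2 + q ^ 2 + δ ^ 2) * √(p' ^ 2 + q' ^ 2 + δ ^ 2) := by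
    rw [← Real.sqrt_mul (by positivity)]
    apply Real.le_sqrt_of_sq_le
    nlinarith [sq_nonneg (p * q' - q * p'), sq_nonneg (δ * (p - p')), sq_nonneg (δ * (q - q'))]
  nlinarith

/-- The Jensen gap of `p ↦ √(|p|² + δ²)` is controlled by its second derivative bound `1 / δ`. -/
theorem sqrt_jensen_gap_le {δ a b : ℝ} (hδ : 0 < δ) (ha : 0 ≤ a) (hb : 0 ≤ b) (hab : a + b = 1)
    (p q p' q' : ℝ) :
    a * √(p ^ 2 + q ^ 2 + δ ^ 2) + b * √(p' ^ 2 + q' ^ 2 + δ ^ 2)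
        - √((a * p + b * p') ^ 2 + (a * q + b * q') ^ 2 + δ ^ 2)
      ≤ a * b * ((p - p') ^ 2 + (q - q') ^ 2) / (2 * δ) := by
  have le_sqrt (x y : ℝ) : δ ≤ √(x ^ 2 + y ^ 2 + δ ^ 2) :=
    Real.le_sqrt_of_sq_le (by nlinarith [sq_nonneg x, sq_nonneg y])
  have hs := Real.sq_sqrt (show 0 ≤ p ^ 2 + q ^ 2 + δ ^ 2 by positivity)
  have hs' := Real.sq_sqrt (show 0 ≤ p' ^ 2 + q' ^ 2 + δ ^ 2 by positivity)
  have hm := Real.sq_sqrt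
    (show 0 ≤ (a * p + b * p') ^ 2 + (a * q + b * q') ^ 2 + δ ^ 2 by positivity)
  have ds := le_sqrt p q
  have ds' := le_sqrt p' q'
  have dm := le_sqrt (a * p + b * p') (a * q + b * q')
  set s := √(p ^ 2 + q ^ 2 + δ ^ 2)
  set s' := √(p' ^ 2 + q' ^ 2 + δ ^ 2)
  set m := √((a * p + b * p') ^ 2 + (a * q + b * q') ^ 2 + δ ^ 2)
  have hD : 0 ≤ a * b * ((p - p') ^ 2 + (q - q') ^ 2) := by positivity
  have hS : δ ≤ a * s + b * s' := by
    calc δ = a * δ + b * δ := by rw [← add_mul, hab, one_mul]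
      _ ≤ a * s + b * s' := by gcongr
  have key : (a * s + b * s' - m) * (a * s + b * s' + m)
      = a * b * ((p - p') ^ 2 + (q - q') ^ 2) - a * b * (s - s') ^ 2 := by
    obtain rfl : b = 1 - a := by linarith
    linear_combination a * hs + (1 - a) * hs' - hm
  have hV : 0 ≤ a * b * (s - s') ^ 2 := by positivity
  rw [le_div_iff₀ (by positivity)]
  rcases le_total (a * s + b * s') m with h | h
  · nlinarith
  · nlinarith [mul_nonneg (sub_nonneg.2 h) (show 0 ≤ a * s + b * s' + m - 2 * δ by linarith)]

theorem convexOn_coupling {δ : ℝ} (hδ : 0 < δ) :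
    ConvexOn ℝ {v : Fin 7 → ℝ | 0 < v 4 ∧ v 4 < 1} (fun v =>
      (v 4 - √(v 1 ^ 2 + v 2 ^ 2 + δ ^ 2)) ^ 2 + (1 / δ) * (v 1 ^ 2 + v 2 ^ 2)) := by
  have hc : Convex ℝ {v : Fin 7 → ℝ | 0 < v 4 ∧ v 4 < 1} :=
    (convex_Ioo (0 : ℝ) 1).linear_preimage (LinearMap.proj (R := ℝ) (φ := fun _ : Fin 7 => ℝ) 4)
  refine ⟨hc, fun x hx y hy a b ha hb hab => ?_⟩
  obtain ⟨h0, h1⟩ := hc hx hy ha hb hab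
  have gap := sqrt_jensen_gap_le hδ ha hb hab (x 1) (x 2) (y 1) (y 2)
  have lip := sq_sqrt_sub_sqrt_le_s2 (x 1) (x 2) (y 1) (y 2) δ
  have hs := Real.sq_sqrt (show 0 ≤ x 1 ^ 2 + x 2 ^ 2 + δ ^ 2 by positivity)
  have hs' := Real.sq_sqrt (show 0 ≤ y 1 ^ 2 + y 2 ^ 2 + δ ^ 2 by positivity)
  have hm := Real.sq_sqrt (show 0 ≤ (a * x 1 + b * y 1) ^ 2 + (a * x 2 + b * y 2) ^ 2 + δ ^ 2
    by positivity)
  simp only [Pi.add_apply, Pi.smul_apply, smul_eq_mul] at h0 h1 ⊢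
  set s := √(x 1 ^ 2 + x 2 ^ 2 + δ ^ 2)
  set s' := √(y 1 ^ 2 + y 2 ^ 2 + δ ^ 2)
  set m := √((a * x 1 + b * y 1) ^ 2 + (a * x 2 + b * y 2) ^ 2 + δ ^ 2)
  set D := (x 1 - y 1) ^ 2 + (x 2 - y 2) ^ 2 with hD
  have hgap : 2 * (a * x 4 + b * y 4) * (a * s + b * s' - m) ≤ a * b * D / δ := by
    have e : a * b * D / δ = 2 * (a * b * D / (2 * δ)) := by field_simp
    have hG : 0 ≤ a * b * D / (2 * δ) := by positivity
    rw [e]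
    nlinarith [mul_le_mul_of_nonneg_left gap h0.le, mul_le_mul_of_nonneg_right h1.le hG]
  have hcov : 0 ≤ a * b * ((x 4 - y 4) ^ 2 + D - 2 * (x 4 - y 4) * (s - s')) := by
    have : 0 ≤ (x 4 - y 4) ^ 2 + D - 2 * (x 4 - y 4) * (s - s') := by
      nlinarith [sq_nonneg (x 4 - y 4 - (s - s'))]
    positivity
  have key : a * ((x 4 - s) ^ 2 + 1 / δ * (x 1 ^ 2 + x 2 ^ 2))
        + b * ((y 4 - s') ^ 2 + 1 / δ * (y 1 ^ 2 + y 2 ^ 2))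
        - ((a * x 4 + b * y 4 - m) ^ 2
          + 1 / δ * ((a * x 1 + b * y 1) ^ 2 + (a * x 2 + b * y 2) ^ 2))
      = a * b * ((x 4 - y 4) ^ 2 + D - 2 * (x 4 - y 4) * (s - s'))
        + (a * b * D / δ - 2 * (a * x 4 + b * y 4) * (a * s + b * s' - m)) := by
    obtain rfl : b = 1 - a := by linarith
    rw [hD]
    linear_combination a * hs + (1 - a) * hs' - hm
  linarith

/-- the pointwise convex–concave decomposition of the regularized
binary fluid-surfactant free energy density: (i) `e_c` is convex on `{0 < v₅ < 1}`;
(ii) `e_e` is convex on `ℝ⁷`; (iii) `e_c − e_e` equals the original energy density. -/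
theorem energy_density_convex_concave_decomposition
    (ε η ξ α β δ : ℝ) (hε : 0 < ε) (hη : 0 < η) (hξ : 0 < ξ)
    (hα : 0 < α) (hβ : 0 < β) (hδ : 0 < δ) :
    ConvexOn ℝ {v : Fin 7 → ℝ | 0 < v 4 ∧ v 4 < 1} (ec ε η ξ α β δ)
    ∧ ConvexOn ℝ (Set.univ : Set (Fin 7 → ℝ)) (ee ε α δ)
    ∧ ∀ v : Fin 7 → ℝ, 0 < v 4 → v 4 < 1 →
        ec ε η ξ α β δ v - ee ε α δ v
          = (1 / (4 * ε)) * (v 0) ^ 2 * (1 - v 0) ^ 2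
            + (ε / 2) * ((v 1) ^ 2 + (v 2) ^ 2) + (η ^ 2 / 2) * (v 3) ^ 2
            + (ξ / 2) * ((v 5) ^ 2 + (v 6) ^ 2)
            + (α / 2) * (v 4 - Real.sqrt ((v 1) ^ 2 + (v 2) ^ 2 + δ ^ 2)) ^ 2
            + β * FH (v 4) := by
  have sq (i : Fin 7) := convexOn_coord_sq i
  have h2 : 0 ≤ √2 - 1 := sub_nonneg.2 (Real.one_le_sqrt.2 one_le_two)
  have hc := convexOn_coupling hδ
  refine ⟨?_, ?_, fun v _ _ => ?_⟩
  · have hFH : ConvexOn ℝ {v : Fin 7 → ℝ | 0 < v 4 ∧ v 4 < 1} (fun v => FH (v 4)) :=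
      (convexOn_FH.comp_linearMap (LinearMap.proj (R := ℝ) (φ := fun _ : Fin 7 => ℝ) 4)).subset
        (fun v hv => ⟨hv.1.le, hv.2.le⟩) hc.1
    have hpoly := (((((convexOn_even_pow_coord_sub (n := 4) (by decide) (0 : Fin 7) (1 / 2)).smul
      (show 0 ≤ 1 / (4 * ε) by positivity)).add_const (1 / (64 * ε))).add
      (((sq 1).add (sq 2)).smul (show 0 ≤ ε / 2 by positivity))).add
      ((sq 3).smul (show 0 ≤ η ^ 2 / 2 by positivity))).add
      (((sq 5).add (sq 6)).smul (show 0 ≤ ξ / 2 by positivity))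
    refine (((hpoly.subset (Set.subset_univ _) hc.1).add (hFH.smul hβ.le)).add
      ((hc.add (((sq 4).smul h2).subset (Set.subset_univ _) hc.1)).smul
        (show 0 ≤ α / 2 by positivity))).congr fun v _ => ?_
    simp only [ec, Pi.add_apply, smul_eq_mul]
    ring
  · exact ((convexOn_even_pow_coord_sub even_two (0 : Fin 7) (1 / 2)).smul
      (show 0 ≤ 1 / (8 * ε) by positivity)).add
      ((((sq 4).smul h2).add (((sq 1).add (sq 2)).smul (show 0 ≤ 1 / δ by positivity))).smul
        (show 0 ≤ α / 2 by positivity))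
  · simp only [ec, ee]
    field_simp
    ring
end
end

section
/- Let δ > 0 and α > 0. The function f : ℝ⁵ → ℝ defined by f(ρ, v₁, v₂, v₃, v₄) = (α/2)·[ (ρ − √( (1/2)(v₁² + v₂² + v₃² + v₄²) + δ² ))² + (√2 − 1)·ρ² + (1/(2δ))·(v₁² + v₂² + v₃² + v₄²) ] is convex on the convex set { (ρ, v₁, v₂, v₃, v₄) ∈ ℝ⁵ : 0 < ρ < 1 }. -/
/-- A regularized norm is `1`-Lipschitz: the squared difference of two values of
`√(|v|² / 2 + δ²)` is at most half the squared distance of the arguments. -/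
lemma sq_sub_le_of_sq_eq_half_sum_add_sq {δ g h x₁ x₂ x₃ x₄ y₁ y₂ y₃ y₄ : ℝ}
    (hg : 0 ≤ g) (hh : 0 ≤ h)
    (hgx : g ^ 2 = (1 / 2) * (x₁ ^ 2 + x₂ ^ 2 + x₃ ^ 2 + x₄ ^ 2) + δ ^ 2)
    (hhy : h ^ 2 = (1 / 2) * (y₁ ^ 2 + y₂ ^ 2 + y₃ ^ 2 + y₄ ^ 2) + δ ^ 2) :
    (g - h) ^ 2 ≤
      (1 / 2) * ((x₁ - y₁) ^ 2 + (x₂ - y₂) ^ 2 + (x₃ - y₃) ^ 2 + (x₄ - y₄) ^ 2) := by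
  have hinner : (1 / 2) * (x₁ * y₁ + x₂ * y₂ + x₃ * y₃ + x₄ * y₄) + δ ^ 2 ≤ g * h := by
    refine le_of_sq_le_sq ?_ (mul_nonneg hg hh)
    rw [mul_pow, hgx, hhy]
    linarith [sq_nonneg (x₁ * y₂ - x₂ * y₁), sq_nonneg (x₁ * y₃ - x₃ * y₁),
      sq_nonneg (x₁ * y₄ - x₄ * y₁), sq_nonneg (x₂ * y₃ - x₃ * y₂),
      sq_nonneg (x₂ * y₄ - x₄ * y₂), sq_nonneg (x₃ * y₄ - x₄ * y₃),
      sq_nonneg (δ * (x₁ - y₁)), sq_nonneg (δ * (x₂ - y₂)),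
      sq_nonneg (δ * (x₃ - y₃)), sq_nonneg (δ * (x₄ - y₄))]
  linarith

/-- If `g² = a g₁² + b g₂² - a b D` with `g` at least `δ`, then the convexity defect
`a g₁ + b g₂ - g` is at most `a b D / (2 δ)`. -/
lemma convex_comb_sub_le_of_sq_eq {δ a b g₁ g₂ g D : ℝ} (hδ : 0 < δ) (ha : 0 ≤ a) (hb : 0 ≤ b)
    (hab : a + b = 1) (hg : δ ≤ g) (hD : 0 ≤ D)
    (hsq : g ^ 2 = a * g₁ ^ 2 + b * g₂ ^ 2 - a * b * D) :
    2 * (a * g₁ + b * g₂ - g) ≤ 1 / δ * (a * b * D) := by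
  obtain rfl : b = 1 - a := by linarith
  have hP : 0 ≤ a * (1 - a) := mul_nonneg ha hb
  have hPD : 0 ≤ a * (1 - a) * D := mul_nonneg hP hD
  rw [one_div, inv_mul_eq_div, le_div_iff₀ hδ]
  rcases le_total (a * g₁ + (1 - a) * g₂ - g) 0 with hneg | hpos
  · nlinarith
  · have hvar := mul_nonneg hP (sq_nonneg (g₁ - g₂))
    have hmul := mul_nonneg hpos
      (by linarith : 0 ≤ a * g₁ + (1 - a) * g₂ + g - 2 * δ)
    linarith

/-- convexity of the coupled part of the fully discrete energy `E_c`: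
for `δ > 0`, `α > 0`, the map
`(ρ, v₁, v₂, v₃, v₄) ↦ (α/2)·[(ρ − √((1/2)(v₁²+v₂²+v₃²+v₄²) + δ²))² + (√2−1)ρ² + (1/(2δ))(v₁²+v₂²+v₃²+v₄²)]`
is convex on `{0 < ρ < 1}`. -/
theorem discrete_coupled_part_convex (δ α : ℝ) (hδ : 0 < δ) (hα : 0 < α) :
    ConvexOn ℝ {p : ℝ × ℝ × ℝ × ℝ × ℝ | 0 < p.1 ∧ p.1 < 1}
      (fun p : ℝ × ℝ × ℝ × ℝ × ℝ =>
        (α / 2) * ((p.1 - Real.sqrt ((1 / 2) * (p.2.1 ^ 2 + p.2.2.1 ^ 2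
              + p.2.2.2.1 ^ 2 + p.2.2.2.2 ^ 2) + δ ^ 2)) ^ 2
          + (Real.sqrt 2 - 1) * p.1 ^ 2
          + (1 / (2 * δ)) * (p.2.1 ^ 2 + p.2.2.1 ^ 2
              + p.2.2.2.1 ^ 2 + p.2.2.2.2 ^ 2))) := by
  have hset : {p : ℝ × ℝ × ℝ × ℝ × ℝ | 0 < p.1 ∧ p.1 < 1} = Prod.fst ⁻¹' Set.Ioo 0 1 := rfl
  refine ⟨hset ▸ (convex_Ioo (0 : ℝ) 1).linear_preimage (LinearMap.fst ℝ ℝ _), ?_⟩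
  rintro ⟨r, x₁, x₂, x₃, x₄⟩ ⟨hr₀, hr₁⟩ ⟨s, y₁, y₂, y₃, y₄⟩ ⟨hs₀, hs₁⟩ a b ha hb hab
  simp only [Prod.smul_mk, Prod.mk_add_mk, smul_eq_mul] at hr₀ hr₁ hs₀ hs₁ ⊢
  have hsq (z₁ z₂ z₃ z₄ : ℝ) := Real.sq_sqrt
    (by positivity : 0 ≤ (1 / 2) * (z₁ ^ 2 + z₂ ^ 2 + z₃ ^ 2 + z₄ ^ 2) + δ ^ 2)
  have hle (z₁ z₂ z₃ z₄ : ℝ) :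
      δ ≤ √((1 / 2) * (z₁ ^ 2 + z₂ ^ 2 + z₃ ^ 2 + z₄ ^ 2) + δ ^ 2) :=
    Real.le_sqrt_of_sq_le (le_add_of_nonneg_left (by positivity))
  have hx := hsq x₁ x₂ x₃ x₄
  have hy := hsq y₁ y₂ y₃ y₄
  have hz := hsq (a * x₁ + b * y₁) (a * x₂ + b * y₂) (a * x₃ + b * y₃) (a * x₄ + b * y₄)
  have hx' := hle x₁ x₂ x₃ x₄
  have hy' := hle y₁ y₂ y₃ y₄
  have hz' := hle (a * x₁ + b * y₁) (a * x₂ + b * y₂) (a * x₃ + b * y₃) (a * x₄ + b * y₄)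
  generalize √((1 / 2) * (x₁ ^ 2 + x₂ ^ 2 + x₃ ^ 2 + x₄ ^ 2) + δ ^ 2) = g₁ at *
  generalize √((1 / 2) * (y₁ ^ 2 + y₂ ^ 2 + y₃ ^ 2 + y₄ ^ 2) + δ ^ 2) = g₂ at *
  generalize √((1 / 2) * ((a * x₁ + b * y₁) ^ 2 + (a * x₂ + b * y₂) ^ 2 +
    (a * x₃ + b * y₃) ^ 2 + (a * x₄ + b * y₄) ^ 2) + δ ^ 2) = g at *
  have hlip := sq_sub_le_of_sq_eq_half_sum_add_sq (hδ.le.trans hx') (hδ.le.trans hy') hx hy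
  obtain ⟨D, hD⟩ : ∃ D, D =
      (1 / 2) * ((x₁ - y₁) ^ 2 + (x₂ - y₂) ^ 2 + (x₃ - y₃) ^ 2 + (x₄ - y₄) ^ 2) := ⟨_, rfl⟩
  rw [← hD] at hlip
  have hD₀ : 0 ≤ D := by rw [hD]; positivity
  obtain rfl : b = 1 - a := by linarith
  have hP : 0 ≤ a * (1 - a) := mul_nonneg ha hb
  have hg : g ^ 2 = a * g₁ ^ 2 + (1 - a) * g₂ ^ 2 - a * (1 - a) * D := by
    rw [hx, hy, hz, hD]; ring
  have hdefect := convex_comb_sub_le_of_sq_eq hδ ha hb hab hz' hD₀ hg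
  have hE : 0 ≤ 1 / δ * (a * (1 - a) * D) := by positivity
  have hρ₀ : 0 ≤ a * r + (1 - a) * s := by positivity
  have hρ₁ : a * r + (1 - a) * s ≤ 1 := by nlinarith
  have hscaled := (mul_le_mul_of_nonneg_left hdefect hρ₀).trans
    (mul_le_of_le_one_left hE hρ₁)
  have hcross : 0 ≤ a * (1 - a) * ((r - s) ^ 2 + D - 2 * (r - s) * (g₁ - g₂)) :=
    mul_nonneg hP (by linarith [sq_nonneg ((r - s) - (g₁ - g₂))])
  have hsqrt : 0 ≤ (√2 - 1) * (a * (1 - a) * (r - s) ^ 2) :=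
    mul_nonneg (sub_nonneg.2 (Real.one_le_sqrt.2 one_le_two)) (by positivity)
  have hinv : 1 / (2 * δ) = 1 / δ * (1 / 2) := by rw [one_div_mul_one_div, mul_comm]
  rw [hinv, mul_left_comm a, mul_left_comm (1 - a), ← mul_add]
  refine mul_le_mul_of_nonneg_left ?_ (by positivity)
  rw [hD] at hscaled hcross hg
  linarith
end

section
/- Let E be a finite-dimensional real inner product space, let F_c, F_e : E → ℝ be convex and differentiable on E, let G : E → E be a self-adjoint linear operator with ⟪G v, v⟫ ≥ 0 for all v ∈ E, and let τ > 0. Suppose x, x⁺ ∈ E satisfy x⁺ − x = −τ · G(∇F_c(x⁺) − ∇F_e(x)). Then F_c(x⁺) − F_e(x⁺) ≤ F_c(x) − F_e(x). -/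
open scoped RealInnerProductSpace

/-- A convex function lies above its tangent plane at every point of differentiability. -/
theorem ConvexOn.add_fderiv_sub_le {E : Type*} [NormedAddCommGroup E] [NormedSpace ℝ E]
    {s : Set E} {f : E → ℝ} {f' : E →L[ℝ] ℝ} {x y : E} (hf : ConvexOn ℝ s f)
    (hx : x ∈ s) (hy : y ∈ s) (hf' : HasFDerivAt f f' x) :
    f x + f' (y - x) ≤ f y := by
  have hline := hf.comp_affineMap (AffineMap.lineMap x y)
  have hderiv : HasDerivAt (f ∘ AffineMap.lineMap x y) (f' (y - x)) (0 : ℝ) := by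
    refine HasFDerivAt.comp_hasDerivAt (0 : ℝ) ?_ AffineMap.hasDerivAt_lineMap
    simpa using hf'
  have h := hline.le_slope_of_hasDerivAt (by simpa using hx) (by simpa using hy)
    zero_lt_one hderiv
  simp only [slope_def_field, Function.comp_apply, AffineMap.lineMap_apply_zero,
    AffineMap.lineMap_apply_one, sub_zero, div_one] at h
  linarith

/-- The gradient inequality for convex functions. -/
theorem ConvexOn.add_inner_gradient_sub_le {E : Type*} [NormedAddCommGroup E]
    [InnerProductSpace ℝ E] [CompleteSpace E] {s : Set E} {f : E → ℝ} {x y : E}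
    (hf : ConvexOn ℝ s f) (hx : x ∈ s) (hy : y ∈ s) (hf' : DifferentiableAt ℝ f x) :
    f x + ⟪gradient f x, y - x⟫ ≤ f y := by
  simpa using hf.add_fderiv_sub_le hx hy hf'.hasGradientAt.hasFDerivAt

/-- abstract unconditional energy stability of the convex-splitting scheme.
If `F_c, F_e` are convex differentiable, `G` is a self-adjoint positive semidefinite linear
operator, `τ > 0`, and `x⁺ − x = −τ·G(∇F_c(x⁺) − ∇F_e(x))`, then
`F_c(x⁺) − F_e(x⁺) ≤ F_c(x) − F_e(x)`. -/
theorem convex_splitting_energy_stability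
    {E : Type*} [NormedAddCommGroup E] [InnerProductSpace ℝ E] [FiniteDimensional ℝ E]
    (Fc Fe : E → ℝ)
    (hFc : ConvexOn ℝ Set.univ Fc) (hFe : ConvexOn ℝ Set.univ Fe)
    (hFc' : Differentiable ℝ Fc) (hFe' : Differentiable ℝ Fe)
    (G : E →ₗ[ℝ] E)
    (hGsym : ∀ u v : E, ⟪G u, v⟫ = ⟪u, G v⟫)
    (hGpos : ∀ v : E, 0 ≤ ⟪G v, v⟫)
    (τ : ℝ) (hτ : 0 < τ)
    (x xp : E)
    (hscheme : xp - x = -(τ • G (gradient Fc xp - gradient Fe x))) :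
    Fc xp - Fe xp ≤ Fc x - Fe x := by
  have hc := hFc.add_inner_gradient_sub_le (Set.mem_univ xp) (Set.mem_univ x) (hFc' xp)
  have he := hFe.add_inner_gradient_sub_le (Set.mem_univ x) (Set.mem_univ xp) (hFe' x)
  set w := gradient Fc xp - gradient Fe x with hw
  have hdissip : ⟪w, xp - x⟫ ≤ 0 := by
    rw [hscheme, inner_neg_right, inner_smul_right, real_inner_comm]
    exact neg_nonpos.2 (mul_nonneg hτ.le (hGpos w))
  rw [hw, inner_sub_left] at hdissip
  rw [← neg_sub xp x, inner_neg_right] at hc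
  linarith
end

section
/- Fix L > 0, a positive integer N, h = L/N, and parameters ε, η, ξ, α, β, δ, 𝓜, Δt > 0. Let φⁿ, ρⁿ, φⁿ⁺¹, ρⁿ⁺¹ be grid functions with 0 < ρⁿ_{i,j} < 1 and 0 < ρⁿ⁺¹_{i,j} < 1 for all i,j, and suppose they satisfy the convex splitting scheme: (φⁿ⁺¹ − φⁿ)/Δt = 𝓜·Δ_h μ_φ and (ρⁿ⁺¹ − ρⁿ)/Δt = 𝓜·Δ_h μ_ρ, where μ_φ = (1/ε)(φⁿ⁺¹ − 1/2)³ − (ε + α + α/δ)·Δ_h φⁿ⁺¹ + η²·Δ_h(Δ_h φⁿ⁺¹) + α·𝒟(ρⁿ⁺¹, φⁿ⁺¹) − (1/(4ε))(φⁿ − 1/2) + (α/δ)·Δ_h φⁿ, and μ_ρ = −ξ·Δ_h ρⁿ⁺¹ + β·(ln ρⁿ⁺¹ − ln(1 − ρⁿ⁺¹)) + √2·α·ρⁿ⁺¹ − α·𝒜|∇_h^δ φⁿ⁺¹| − α(√2 − 1)·ρⁿ (all operations pointwise). Then E(φⁿ⁺¹, ρⁿ⁺¹) ≤ E(φⁿ,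 ρⁿ), where E(φ,ρ) = h²·Σ_{i,j} [ (1/(4ε))φ_{i,j}²(1 − φ_{i,j})² + (η²/2)(Δ_h φ)_{i,j}² + (α/2)(ρ_{i,j} − 𝒜|∇_h^δ φ|_{i,j})² + β·H(ρ_{i,j}) ] + (ε/2)·‖∇_h φ‖₂² + (ξ/2)·‖∇_h ρ‖₂². -/
open scoped BigOperators

noncomputable section

/-- A periodic grid function on the uniform `N × N` grid. -/
abbrev GF (N : ℕ) := ZMod N × ZMod N → ℝ

/-- Forward difference in the `x`-direction: `(D_x u)_{i,j} = (u_{i+1,j} − u_{i,j})/h`. -/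
def Dx {N : ℕ} (h : ℝ) (u : GF N) : GF N := fun p => (u (p.1 + 1, p.2) - u p) / h

/-- Forward difference in the `y`-direction: `(D_y u)_{i,j} = (u_{i,j+1} − u_{i,j})/h`. -/
def Dy {N : ℕ} (h : ℝ) (u : GF N) : GF N := fun p => (u (p.1, p.2 + 1) - u p) / h

/-- Discrete Laplacian:
`(Δ_h u)_{i,j} = (u_{i+1,j} + u_{i−1,j} + u_{i,j+1} + u_{i,j−1} − 4u_{i,j})/h²`. -/
def lap {N : ℕ} (h : ℝ) (u : GF N) : GF N := fun p =>
  (u (p.1 + 1, p.2) + u (p.1 - 1, p.2) + u (p.1, p.2 + 1) + u (p.1, p.2 - 1) - 4 * u p) / h ^ 2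

/-- Averaged regularized gradient magnitude
`𝒜|∇_h^δ u|_{i,j} = √((1/2)[(D_x u)_{i,j}² + (D_x u)_{i−1,j}² + (D_y u)_{i,j}² + (D_y u)_{i,j−1}²] + δ²)`. -/
def aGrad {N : ℕ} (h δ : ℝ) (u : GF N) : GF N := fun p =>
  Real.sqrt ((1 / 2) * ((Dx h u p) ^ 2 + (Dx h u (p.1 - 1, p.2)) ^ 2
    + (Dy h u p) ^ 2 + (Dy h u (p.1, p.2 - 1)) ^ 2) + δ ^ 2)

/-- Discrete gradient norm squared `‖∇_h u‖₂² = h²·Σ_{i,j} ((D_x u)² + (D_y u)²)`. -/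
def gradNormSq {N : ℕ} [NeZero N] (h : ℝ) (u : GF N) : ℝ :=
  h ^ 2 * ∑ p : ZMod N × ZMod N, ((Dx h u p) ^ 2 + (Dy h u p) ^ 2)

/-- The edge coefficient `g_{i,j} = ρ_{i,j} / 𝒜|∇_h^δ φ|_{i,j}`. -/
def gfun {N : ℕ} (h δ : ℝ) (ρ φ : GF N) : GF N := fun p => ρ p / aGrad h δ φ p

/-- The averaged-coefficient discrete divergence
`𝒟(ρ,φ) = ∇_h · (𝒜(ρ/𝒜|∇_h^δ φ|) ∇_h φ)` with `g = ρ/𝒜|∇_h^δ φ|`. -/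
def divD {N : ℕ} (h δ : ℝ) (ρ φ : GF N) : GF N := fun p =>
  (1 / h) * ((1 / 2) * (gfun h δ ρ φ p + gfun h δ ρ φ (p.1 + 1, p.2)) * Dx h φ p
    - (1 / 2) * (gfun h δ ρ φ (p.1 - 1, p.2) + gfun h δ ρ φ p) * Dx h φ (p.1 - 1, p.2)
    + (1 / 2) * (gfun h δ ρ φ p + gfun h δ ρ φ (p.1, p.2 + 1)) * Dy h φ p
    - (1 / 2) * (gfun h δ ρ φ (p.1, p.2 - 1) + gfun h δ ρ φ p) * Dy h φ (p.1, p.2 - 1))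

/-- The discrete chemical potential `μ_φ` of the convex splitting scheme. -/
def muPhi {N : ℕ} (h ε η α δ : ℝ) (φn φ ρ : GF N) : GF N := fun p =>
  (1 / ε) * (φ p - 1 / 2) ^ 3 - (ε + α + α / δ) * lap h φ p
    + η ^ 2 * lap h (lap h φ) p + α * divD h δ ρ φ p
    - (1 / (4 * ε)) * (φn p - 1 / 2) + (α / δ) * lap h φn p

/-- The discrete chemical potential `μ_ρ` of the convex splitting scheme. -/
def muRho {N : ℕ} (h ξ α β δ : ℝ) (ρn φ ρ : GF N) : GF N := fun p =>
  -ξ * lap h ρ p + β * (Real.log (ρ p) - Real.log (1 - ρ p))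
    + Real.sqrt 2 * α * ρ p - α * aGrad h δ φ p - α * (Real.sqrt 2 - 1) * ρn p

/-- The discrete energy `E(φ,ρ)`. -/
def energyE {N : ℕ} [NeZero N] (h ε η ξ α β δ : ℝ) (φ ρ : GF N) : ℝ :=
  h ^ 2 * ∑ p : ZMod N × ZMod N,
      ((1 / (4 * ε)) * (φ p) ^ 2 * (1 - φ p) ^ 2 + (η ^ 2 / 2) * (lap h φ p) ^ 2
        + (α / 2) * (ρ p - aGrad h δ φ p) ^ 2 + β * FH (ρ p))
    + (ε / 2) * gradNormSq h φ + (ξ / 2) * gradNormSq h ρ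

/-- The symmetric form `½[D_x u D_x v + D_y u D_y v]` summed over the four edges at each node. -/
def avgGradProd {N : ℕ} (h : ℝ) (u v : GF N) : GF N := fun p =>
  (1 / 2) * (Dx h u p * Dx h v p + Dx h u (p.1 - 1, p.2) * Dx h v (p.1 - 1, p.2)
    + Dy h u p * Dy h v p + Dy h u (p.1, p.2 - 1) * Dy h v (p.1, p.2 - 1))

/-- The discrete divergence `∇_h · (𝒜g ∇_h φ)` for a nodal coefficient `g`. -/
def coeffDiv {N : ℕ} (h : ℝ) (g φ : GF N) : GF N := fun p =>
  (1 / h) * ((1 / 2) * (g p + g (p.1 + 1, p.2)) * Dx h φ p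
    - (1 / 2) * (g (p.1 - 1, p.2) + g p) * Dx h φ (p.1 - 1, p.2)
    + (1 / 2) * (g p + g (p.1, p.2 + 1)) * Dy h φ p
    - (1 / 2) * (g (p.1, p.2 - 1) + g p) * Dy h φ (p.1, p.2 - 1))

section SummationByParts

variable {N : ℕ}

lemma lap_eq_coeffDiv (h : ℝ) (u : GF N) : lap h u = coeffDiv h (fun _ => 1) u := by
  funext p
  simp only [lap, coeffDiv, Dx, Dy, sub_add_cancel]
  ring

lemma divD_eq_coeffDiv (h δ : ℝ) (ρ φ : GF N) :
    divD h δ ρ φ = coeffDiv h (gfun h δ ρ φ) φ := rfl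

lemma avgGradProd_comm (h : ℝ) (u v : GF N) (p : ZMod N × ZMod N) :
    avgGradProd h u v p = avgGradProd h v u p := by
  simp only [avgGradProd]; ring

variable [NeZero N]

lemma sum_shift_fst (f : GF N) : ∑ p : ZMod N × ZMod N, f (p.1 - 1, p.2) = ∑ p, f p :=
  ((Equiv.subRight (1 : ZMod N)).prodCongr (Equiv.refl _)).sum_comp f

lemma sum_shift_snd (f : GF N) : ∑ p : ZMod N × ZMod N, f (p.1, p.2 - 1) = ∑ p, f p :=
  ((Equiv.refl _).prodCongr (Equiv.subRight (1 : ZMod N))).sum_comp f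

lemma sum_mul_coeffDiv (h : ℝ) (g φ ψ : GF N) :
    ∑ p, coeffDiv h g φ p * ψ p = -∑ p, g p * avgGradProd h φ ψ p := by
  have hx := sum_shift_fst fun p : ZMod N × ZMod N =>
    (1 / h) * ((1 / 2) * (g p + g (p.1 + 1, p.2)) * Dx h φ p * ψ (p.1 + 1, p.2))
  have hy := sum_shift_snd fun p : ZMod N × ZMod N =>
    (1 / h) * ((1 / 2) * (g p + g (p.1, p.2 + 1)) * Dy h φ p * ψ (p.1, p.2 + 1))
  have hgx := sum_shift_fst fun p : ZMod N × ZMod N =>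
    (1 / 2) * g (p.1 + 1, p.2) * (Dx h φ p * Dx h ψ p)
  have hgy := sum_shift_snd fun p : ZMod N × ZMod N =>
    (1 / 2) * g (p.1, p.2 + 1) * (Dy h φ p * Dy h ψ p)
  rw [← sub_eq_zero, ← Finset.sum_sub_distrib] at hx hy hgx hgy
  have hsum : ∑ p, coeffDiv h g φ p * ψ p + ∑ p, g p * avgGradProd h φ ψ p = -0 - 0 + 0 + 0 := by
    nth_rewrite 1 [← hx]
    nth_rewrite 1 [← hy]
    nth_rewrite 1 [← hgx]
    nth_rewrite 1 [← hgy]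
    simp only [← Finset.sum_neg_distrib, ← Finset.sum_sub_distrib, ← Finset.sum_add_distrib]
    refine Finset.sum_congr rfl fun p _ => ?_
    simp only [coeffDiv, avgGradProd, Dx, Dy, sub_add_cancel]
    ring
  linarith

lemma sum_lap_mul (h : ℝ) (u v : GF N) :
    ∑ p, lap h u p * v p = -∑ p, avgGradProd h u v p := by
  simp [lap_eq_coeffDiv, sum_mul_coeffDiv]

lemma sum_lap_lap_mul (h : ℝ) (u v : GF N) :
    ∑ p, lap h (lap h u) p * v p = ∑ p, lap h u p * lap h v p := by
  rw [sum_lap_mul]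
  simp_rw [avgGradProd_comm h (lap h u) v]
  rw [← sum_lap_mul]
  exact Finset.sum_congr rfl fun p _ => mul_comm _ _

lemma sum_lap_mul_self_nonpos (h : ℝ) (u : GF N) : ∑ p, lap h u p * u p ≤ 0 := by
  rw [sum_lap_mul, neg_nonpos]
  refine Finset.sum_nonneg fun p _ => ?_
  simp only [avgGradProd, ← sq]
  positivity

lemma gradNormSq_eq_sum_avgGradProd (h : ℝ) (u : GF N) :
    gradNormSq h u = h ^ 2 * ∑ p, avgGradProd h u u p := by
  have hx := sum_shift_fst fun p : ZMod N × ZMod N => Dx h u p * Dx h u p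
  have hy := sum_shift_snd fun p : ZMod N × ZMod N => Dy h u p * Dy h u p
  simp only [gradNormSq, avgGradProd, ← Finset.mul_sum, Finset.sum_add_distrib] at *
  rw [hx, hy]
  simp only [← sq]
  ring

lemma energyE_eq_sum (h ε η ξ α β δ : ℝ) (φ ρ : GF N) :
    energyE h ε η ξ α β δ φ ρ = h ^ 2 * ∑ p,
      ((1 / (4 * ε)) * (φ p) ^ 2 * (1 - φ p) ^ 2 + (η ^ 2 / 2) * (lap h φ p) ^ 2
        + (α / 2) * (ρ p - aGrad h δ φ p) ^ 2 + β * FH (ρ p)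
        + (ε / 2) * avgGradProd h φ φ p + (ξ / 2) * avgGradProd h ρ ρ p) := by
  simp only [energyE, gradNormSq_eq_sum_avgGradProd, Finset.sum_add_distrib, ← Finset.mul_sum]
  ring

lemma sum_muPhi_mul (h ε η α δ : ℝ) (φn φ ρ d : GF N) :
    ∑ p, muPhi h ε η α δ φn φ ρ p * d p = ∑ p,
      ((1 / ε) * (φ p - 1 / 2) ^ 3 * d p + (ε + α + α / δ) * avgGradProd h φ d p
        + η ^ 2 * (lap h φ p * lap h d p) - α * (gfun h δ ρ φ p * avgGradProd h φ d p)
        - (1 / (4 * ε)) * (φn p - 1 / 2) * d p - (α / δ) * avgGradProd h φn d p) := by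
  have hexp : ∀ p, muPhi h ε η α δ φn φ ρ p * d p =
      (1 / ε) * (φ p - 1 / 2) ^ 3 * d p - (ε + α + α / δ) * (lap h φ p * d p)
        + η ^ 2 * (lap h (lap h φ) p * d p) + α * (divD h δ ρ φ p * d p)
        - (1 / (4 * ε)) * (φn p - 1 / 2) * d p + (α / δ) * (lap h φn p * d p) := by
    intro p; simp only [muPhi]; ring
  simp only [hexp, Finset.sum_add_distrib, Finset.sum_sub_distrib]
  simp only [mul_assoc, ← Finset.mul_sum, sum_lap_lap_mul, sum_lap_mul, divD_eq_coeffDiv,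
    sum_mul_coeffDiv]
  ring

lemma sum_muRho_mul (h ξ α β δ : ℝ) (ρn φ ρ d : GF N) :
    ∑ p, muRho h ξ α β δ ρn φ ρ p * d p = ∑ p,
      (ξ * avgGradProd h ρ d p + (β * (Real.log (ρ p) - Real.log (1 - ρ p))
        + Real.sqrt 2 * α * ρ p - α * aGrad h δ φ p - α * (Real.sqrt 2 - 1) * ρn p) * d p) := by
  have hexp : ∀ p, muRho h ξ α β δ ρn φ ρ p * d p = -ξ * (lap h ρ p * d p)
      + (β * (Real.log (ρ p) - Real.log (1 - ρ p))
        + Real.sqrt 2 * α * ρ p - α * aGrad h δ φ p - α * (Real.sqrt 2 - 1) * ρn p) * d p := by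
    intro p; simp only [muRho]; ring
  simp only [hexp, Finset.sum_add_distrib, ← Finset.mul_sum, sum_lap_mul]
  ring

end SummationByParts

section Convexity

variable {N : ℕ}

lemma avgGradProd_sub_right (h : ℝ) (u v w : GF N) (p : ZMod N × ZMod N) :
    avgGradProd h u (fun q => v q - w q) p = avgGradProd h u v p - avgGradProd h u w p := by
  simp only [avgGradProd, Dx, Dy]; ring

lemma lap_sub (h : ℝ) (v w : GF N) (p : ZMod N × ZMod N) :
    lap h (fun q => v q - w q) p = lap h v p - lap h w p := by
  simp only [lap]; ring

lemma two_mul_avgGradProd_le (h : ℝ) (u v : GF N) (p : ZMod N × ZMod N) :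
    2 * avgGradProd h u v p ≤ avgGradProd h u u p + avgGradProd h v v p := by
  simp only [avgGradProd]
  nlinarith [sq_nonneg (Dx h u p - Dx h v p), sq_nonneg (Dy h u p - Dy h v p),
    sq_nonneg (Dx h u (p.1 - 1, p.2) - Dx h v (p.1 - 1, p.2)),
    sq_nonneg (Dy h u (p.1, p.2 - 1) - Dy h v (p.1, p.2 - 1))]

lemma avgGradProd_sq_le (h : ℝ) (u v : GF N) (p : ZMod N × ZMod N) :
    avgGradProd h u v p ^ 2 ≤ avgGradProd h u u p * avgGradProd h v v p := by
  simp only [avgGradProd]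
  generalize Dx h u p = a, Dx h u (p.1 - 1, p.2) = b, Dy h u p = c,
    Dy h u (p.1, p.2 - 1) = d, Dx h v p = a₁, Dx h v (p.1 - 1, p.2) = b₁, Dy h v p = c₁,
    Dy h v (p.1, p.2 - 1) = d₁
  linarith [sq_nonneg (a * b₁ - b * a₁), sq_nonneg (a * c₁ - c * a₁),
    sq_nonneg (a * d₁ - d * a₁), sq_nonneg (b * c₁ - c * b₁), sq_nonneg (b * d₁ - d * b₁),
    sq_nonneg (c * d₁ - d * c₁)]

lemma aGrad_sq (h δ : ℝ) (u : GF N) (p : ZMod N × ZMod N) :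
    aGrad h δ u p ^ 2 = avgGradProd h u u p + δ ^ 2 := by
  rw [aGrad, Real.sq_sqrt (by positivity)]
  simp only [avgGradProd]; ring

lemma le_aGrad {h δ : ℝ} (u : GF N) (p : ZMod N × ZMod N) : δ ≤ aGrad h δ u p := by
  refine Real.le_sqrt_of_sq_le (le_add_of_nonneg_left ?_)
  positivity

lemma avgGradProd_add_sq_le {h δ : ℝ} (u v : GF N) (p : ZMod N × ZMod N) :
    avgGradProd h u v p + δ ^ 2 ≤ aGrad h δ u p * aGrad h δ v p := by
  refine le_of_sq_le_sq ?_ (mul_nonneg (Real.sqrt_nonneg _) (Real.sqrt_nonneg _))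
  rw [mul_pow, aGrad_sq, aGrad_sq]
  nlinarith [avgGradProd_sq_le h u v p,
    mul_le_mul_of_nonneg_left (two_mul_avgGradProd_le h u v p) (sq_nonneg δ)]

lemma FH_sub_le {a b : ℝ} (ha : 0 < a ∧ a < 1) (hb : 0 < b ∧ b < 1) :
    FH a - FH b ≤ (Real.log a - Real.log (1 - a)) * (a - b) := by
  have hlog : ∀ x y : ℝ, 0 < x → 0 < y → y * (Real.log x - Real.log y) ≤ x - y := by
    intro x y hx hy
    have h1 := Real.log_le_sub_one_of_pos (div_pos hx hy)
    rw [Real.log_div hx.ne' hy.ne'] at h1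
    calc y * (Real.log x - Real.log y) ≤ y * (x / y - 1) := by gcongr
      _ = x - y := by field_simp
  have h1 := hlog a b ha.1 hb.1
  have h2 := hlog (1 - a) (1 - b) (by linarith) (by linarith)
  simp only [FH]
  linarith

lemma double_well_sub_le (a b : ℝ) :
    a ^ 2 * (1 - a) ^ 2 - b ^ 2 * (1 - b) ^ 2
      ≤ 4 * (a - 1 / 2) ^ 3 * (a - b) - (b - 1 / 2) * (a - b) := by
  nlinarith [sq_nonneg ((a - 1 / 2) ^ 2 - (b - 1 / 2) ^ 2), sq_nonneg (a - b),
    mul_nonneg (sq_nonneg (a - 1 / 2)) (sq_nonneg (a - b))]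

/-- The coupling inequality with `A = 𝒜|∇_h^δ φ|`, `r = ρ`, and `s`, `c` the values of
`avgGradProd`; index `1` is the new time level and index `0` the old one. -/
lemma coupling_sub_le {δ A₀ A₁ s₀ s₁ c r₀ r₁ : ℝ} (hδ : 0 < δ)
    (h₀ : A₀ ^ 2 = s₀ + δ ^ 2) (h₁ : A₁ ^ 2 = s₁ + δ ^ 2) (hA : δ ≤ A₁)
    (hc : c + δ ^ 2 ≤ A₁ * A₀) (hr₁ : r₁ ≤ 1) :
    (1 / 2) * (r₁ - A₁) ^ 2 - (1 / 2) * (r₀ - A₀) ^ 2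
      ≤ (1 + 1 / δ) * (s₁ - c) - r₁ / A₁ * (s₁ - c) - (1 / δ) * (c - s₀)
        + (Real.sqrt 2 * r₁ - A₁ - (Real.sqrt 2 - 1) * r₀) * (r₁ - r₀) := by
  have hA₁ : 0 < A₁ := hδ.trans_le hA
  have hremainder : r₁ * (A₀ - A₁) + r₁ / A₁ * (s₁ - c) ≤ (1 / δ) * (s₁ + s₀ - 2 * c) := by
    have heq : r₁ * (A₀ - A₁) + r₁ / A₁ * (s₁ - c) = r₁ / A₁ * (A₀ * A₁ - δ ^ 2 - c) := by
      field_simp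
      linear_combination (-r₁) * h₁
    have hcoef : r₁ / A₁ ≤ 1 / δ := div_le_div₀ zero_le_one hr₁ hδ hA
    rw [heq]
    refine mul_le_mul hcoef ?_ (by linarith) (by positivity)
    nlinarith [sq_nonneg (A₀ - A₁)]
  have hsqrt : 1 ≤ Real.sqrt 2 := Real.one_le_sqrt.mpr (by norm_num)
  nlinarith [mul_nonneg (sub_nonneg.mpr hsqrt) (sq_nonneg (r₁ - r₀)),
    sq_nonneg (r₁ - r₀ - (A₁ - A₀)), sq_nonneg (r₁ - r₀ + (A₁ - A₀))]

end Convexity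

/-- The convex splitting inequality: the energy increment is bounded by the pairing of the
chemical potentials with the increments of the unknowns. -/
lemma energyE_sub_le {N : ℕ} [NeZero N] {h ε η ξ α β δ : ℝ}
    (hε : 0 < ε) (hξ : 0 < ξ) (hα : 0 < α) (hβ : 0 < β) (hδ : 0 < δ) {φ₀ ρ₀ φ₁ ρ₁ : GF N}
    (hρ₀ : ∀ p, 0 < ρ₀ p ∧ ρ₀ p < 1) (hρ₁ : ∀ p, 0 < ρ₁ p ∧ ρ₁ p < 1) :
    energyE h ε η ξ α β δ φ₁ ρ₁ - energyE h ε η ξ α β δ φ₀ ρ₀ ≤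
      h ^ 2 * (∑ p, muPhi h ε η α δ φ₀ φ₁ ρ₁ p * (φ₁ p - φ₀ p)
        + ∑ p, muRho h ξ α β δ ρ₀ φ₁ ρ₁ p * (ρ₁ p - ρ₀ p)) := by
  rw [energyE_eq_sum, energyE_eq_sum, ← mul_sub, ← Finset.sum_sub_distrib,
    sum_muPhi_mul h ε η α δ φ₀ φ₁ ρ₁ fun p => φ₁ p - φ₀ p,
    sum_muRho_mul h ξ α β δ ρ₀ φ₁ ρ₁ fun p => ρ₁ p - ρ₀ p, ← Finset.sum_add_distrib]
  refine mul_le_mul_of_nonneg_left (Finset.sum_le_sum fun p _ => ?_) (sq_nonneg h)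
  simp only [avgGradProd_sub_right, lap_sub, gfun]
  have hwell := mul_le_mul_of_nonneg_left (double_well_sub_le (φ₁ p) (φ₀ p))
    (by positivity : 0 ≤ 1 / (4 * ε))
  have hcoupling := mul_le_mul_of_nonneg_left (coupling_sub_le (r₀ := ρ₀ p) hδ
    (aGrad_sq h δ φ₀ p) (aGrad_sq h δ φ₁ p) (le_aGrad φ₁ p) (avgGradProd_add_sq_le φ₁ φ₀ p)
    (hρ₁ p).2.le) hα.le
  have hentropy := mul_le_mul_of_nonneg_left (FH_sub_le (hρ₁ p) (hρ₀ p)) hβ.le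
  have hφ := mul_le_mul_of_nonneg_left (two_mul_avgGradProd_le h φ₁ φ₀ p) hε.le
  have hρ := mul_le_mul_of_nonneg_left (two_mul_avgGradProd_le h ρ₁ ρ₀ p) hξ.le
  have hlap := mul_nonneg (sq_nonneg η) (sq_nonneg (lap h φ₁ p - lap h φ₀ p))
  rw [avgGradProd_comm h φ₀ φ₁]
  have hquarter : 1 / ε = 4 * (1 / (4 * ε)) := by field_simp
  have hdiv : α / δ = α * (1 / δ) := by ring
  rw [hquarter, hdiv]
  linarith

/-- One step of an `H⁻¹` gradient flow dissipates: an increment proportional to the Laplacian of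
the potential pairs nonpositively with the potential. -/
lemma sum_mul_increment_nonpos {N : ℕ} [NeZero N] {h M Δt : ℝ} (hM : 0 < M) (hΔt : 0 < Δt)
    {μ u v : GF N} (hstep : ∀ p, (u p - v p) / Δt = M * lap h μ p) :
    ∑ p, μ p * (u p - v p) ≤ 0 := by
  have hinc : ∀ p, μ p * (u p - v p) = (Δt * M) * (lap h μ p * μ p) := by
    intro p
    rw [(div_eq_iff hΔt.ne').mp (hstep p)]
    ring
  simp only [hinc, ← Finset.mul_sum]
  exact mul_nonpos_of_nonneg_of_nonpos (by positivity) (sum_lap_mul_self_nonpos h μ)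

/-- unconditional energy stability of the convex splitting scheme for the
binary fluid-surfactant system: if `(φⁿ⁺¹, ρⁿ⁺¹)` solves the scheme with data
`(φⁿ, ρⁿ)` and both `ρⁿ, ρⁿ⁺¹` take values in `(0,1)`, then
`E(φⁿ⁺¹, ρⁿ⁺¹) ≤ E(φⁿ, ρⁿ)`. -/
theorem convex_splitting_scheme_energy_stable
    (L : ℝ) (hL : 0 < L) (N : ℕ) [NeZero N] (h : ℝ) (hh : h = L / N)
    (ε η ξ α β δ M Δt : ℝ)
    (hε : 0 < ε) (hη : 0 < η) (hξ : 0 < ξ) (hα : 0 < α) (hβ : 0 < β)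
    (hδ : 0 < δ) (hM : 0 < M) (hΔt : 0 < Δt)
    (φn ρn φnp ρnp : GF N)
    (hρn : ∀ p, 0 < ρn p ∧ ρn p < 1)
    (hρnp : ∀ p, 0 < ρnp p ∧ ρnp p < 1)
    (hschemeφ : ∀ p, (φnp p - φn p) / Δt = M * lap h (muPhi h ε η α δ φn φnp ρnp) p)
    (hschemeρ : ∀ p, (ρnp p - ρn p) / Δt = M * lap h (muRho h ξ α β δ ρn φnp ρnp) p) :
    energyE h ε η ξ α β δ φnp ρnp ≤ energyE h ε η ξ α β δ φn ρn := by
  have hle := energyE_sub_le (h := h) (η := η) (φ₀ := φn) (φ₁ := φnp) hε hξ hα hβ hδ hρn hρnp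
  have hφ := sum_mul_increment_nonpos hM hΔt hschemeφ
  have hρ := sum_mul_increment_nonpos hM hΔt hschemeρ
  have hnonpos := mul_nonpos_of_nonneg_of_nonpos (sq_nonneg h) (add_nonpos hφ hρ)
  linarith
end
end

section
/- Fix L > 0. There exists a constant C₂ > 0 depending only on L such that for every positive integer N, with h = L/N, and every pair of grid functions φ, ψ : (ZMod N) × (ZMod N) → ℝ satisfying Σ_{i,j} φ_{i,j} = 0, Σ_{i,j} ψ_{i,j} = 0, and −(Δ_h ψ)_{i,j} = φ_{i,j} for all i,j, one has ‖ψ‖_∞ ≤ C₂ · ‖φ‖_∞. -/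
open scoped BigOperators

noncomputable section

/-- If the five-point difference `4u − (sum of the neighbours of u)` is bounded by `K`, then the
oscillation of `u` along each row is at most `(9/16) K N²`. The antisymmetrization of `u` under a
reflection is compared with a concave quadratic barrier on a half-period strip. -/
theorem row_oscillation_le {N : ℕ} [NeZero N] (u : GF N) (K : ℝ)
    (hu : ∀ i j, |4 * u (i, j) - (u (i + 1, j) + u (i - 1, j) + u (i, j + 1) + u (i, j - 1))| < K)
    (a a' b : ZMod N) : u (a, b) - u (a', b) ≤ 9 / 16 * K * N ^ 2 := by
  have hK : 0 < K := (abs_nonneg _).trans_lt (hu a b)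
  have hN : (1 : ℝ) ≤ N := by exact_mod_cast NeZero.one_le
  set d : ℕ := (a - a').val
  have hdN : d < N := ZMod.val_lt (a - a')
  have hda : (d : ZMod N) = a - a' := ZMod.natCast_zmod_val _
  let W : ℤ → ZMod N → ℝ := fun t j => u (a' + t, j) - u (a' + d - t, j)
  let B : ℤ → ℝ := fun t => K / 4 * ((2 * t - d + 1) * (N + 1 - (2 * t - d)))
  let S : Finset (ℤ × ZMod N) :=
    ((Finset.Icc (0 : ℤ) N).filter fun t : ℤ => 0 ≤ 2 * t - (d : ℤ) ∧ 2 * t - (d : ℤ) ≤ N) ×ˢ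
      Finset.univ
  have mem_S (t : ℤ) (j : ZMod N) : (t, j) ∈ S ↔ 0 ≤ 2 * t - d ∧ 2 * t - d ≤ N := by
    simp only [S, Finset.mem_product, Finset.mem_filter, Finset.mem_Icc, Finset.mem_univ, and_true]
    omega
  have B_nonneg (t : ℤ) (h₁ : -1 ≤ 2 * t - d) (h₂ : 2 * t - d ≤ N + 1) : 0 ≤ B t := by
    have h₁' : (-1 : ℝ) ≤ 2 * t - d := by exact_mod_cast h₁
    have h₂' : (2 * t - d : ℝ) ≤ N + 1 := by exact_mod_cast h₂
    exact mul_nonneg (by linarith) (mul_nonneg (by linarith) (by linarith))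
  have hne : S.Nonempty := ⟨((d : ℤ), b), (mem_S _ _).2 (by omega)⟩
  obtain ⟨⟨t, j⟩, htS, hmax⟩ := S.exists_max_image (fun q => W q.1 q.2 - B q.1) hne
  have hle : W t j - B t ≤ 0 := by
    by_contra! hpos
    obtain ⟨h₀, h₁⟩ := (mem_S _ _).1 htS
    have hB := B_nonneg t (by omega) (by omega)
    have ht₀ : 2 * t - d ≠ 0 := by
      intro h
      have hcast : ((2 * t - d : ℤ) : ZMod N) = 0 := by rw [h]; simp
      push_cast at hcast
      have : W t j = 0 := by
        have e : a' + d - t = a' + (t : ZMod N) := by linear_combination -hcast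
        simp only [W, e, sub_self]
      linarith
    have ht₁ : 2 * t - d ≠ N := by
      intro h
      have hcast : ((2 * t - d : ℤ) : ZMod N) = 0 := by rw [h]; simp
      push_cast at hcast
      have : W t j = 0 := by
        have e : a' + d - t = a' + (t : ZMod N) := by linear_combination -hcast
        simp only [W, e, sub_self]
      linarith
    have hleft : W (t - 1) j - B (t - 1) ≤ W t j - B t := by
      by_cases h : 2 ≤ 2 * t - d
      · exact hmax (t - 1, j) ((mem_S _ _).2 (by omega))
      · have hB' := B_nonneg (t - 1) (by omega) (by omega)
        have hcast : ((2 * t - d : ℤ) : ZMod N) = 1 := by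
          rw [show 2 * t - d = (1 : ℤ) by omega]; simp
        push_cast at hcast
        have : W (t - 1) j = -W t j := by
          have e₁ : a' + ((t - 1 : ℤ) : ZMod N) = a' + d - t := by
            push_cast; linear_combination hcast
          have e₂ : a' + d - ((t - 1 : ℤ) : ZMod N) = a' + t := by
            push_cast; linear_combination -hcast
          simp only [W, e₁, e₂, neg_sub]
        linarith
    have hright : W (t + 1) j - B (t + 1) ≤ W t j - B t := by
      by_cases h : 2 * t - d + 2 ≤ N
      · exact hmax (t + 1, j) ((mem_S _ _).2 (by omega))
      · have hB' := B_nonneg (t + 1) (by omega) (by omega)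
        have hcast : ((2 * t - d : ℤ) : ZMod N) = -1 := by
          rw [show 2 * t - d = (N - 1 : ℤ) by omega]; simp
        push_cast at hcast
        have : W (t + 1) j = -W t j := by
          have e₁ : a' + ((t + 1 : ℤ) : ZMod N) = a' + d - t := by
            push_cast; linear_combination hcast
          have e₂ : a' + d - ((t + 1 : ℤ) : ZMod N) = a' + t := by
            push_cast; linear_combination -hcast
          simp only [W, e₁, e₂, neg_sub]
        linarith
    have hup : W t (j + 1) - B t ≤ W t j - B t := hmax (t, j + 1) ((mem_S _ _).2 ⟨h₀, h₁⟩)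
    have hdown : W t (j - 1) - B t ≤ W t j - B t := hmax (t, j - 1) ((mem_S _ _).2 ⟨h₀, h₁⟩)
    have hBB : 2 * B t - B (t - 1) - B (t + 1) = 2 * K := by
      simp only [B]; push_cast; ring
    have k₁ := (abs_lt.1 (hu (a' + t) j)).2
    have k₂ := (abs_lt.1 (hu (a' + d - t) j)).1
    have e₁ : a' + (t : ZMod N) + 1 = a' + ((t + 1 : ℤ) : ZMod N) := by push_cast; ring
    have e₂ : a' + (t : ZMod N) - 1 = a' + ((t - 1 : ℤ) : ZMod N) := by push_cast; ring
    have e₃ : a' + d - (t : ZMod N) + 1 = a' + d - ((t - 1 : ℤ) : ZMod N) := by push_cast; ring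
    have e₄ : a' + d - (t : ZMod N) - 1 = a' + d - ((t + 1 : ℤ) : ZMod N) := by push_cast; ring
    rw [e₁, e₂] at k₁
    rw [e₃, e₄] at k₂
    simp only [W] at hleft hright hup hdown
    linarith
  have hWd : W d b = u (a, b) - u (a', b) := by simp [W, hda]
  have hBd : B d ≤ 9 / 16 * K * N ^ 2 := by
    have : ((2 * d - d + 1) * (N + 1 - (2 * d - d)) : ℝ) ≤ 9 / 4 * N ^ 2 := by
      nlinarith [sq_nonneg ((N : ℝ) - 2 * d)]
    calc B d = K / 4 * ((2 * d - d + 1) * (N + 1 - (2 * d - d))) := by simp [B]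
      _ ≤ K / 4 * (9 / 4 * N ^ 2) := by gcongr
      _ = 9 / 16 * K * N ^ 2 := by ring
  have hd_le := hmax ((d : ℤ), b) ((mem_S _ _).2 (by omega))
  simp only at hd_le
  linarith

/-- The oscillation of `u` on the whole grid is at most `(9/8) K N²`. -/
theorem oscillation_le {N : ℕ} [NeZero N] (u : GF N) (K : ℝ)
    (hu : ∀ i j, |4 * u (i, j) - (u (i + 1, j) + u (i - 1, j) + u (i, j + 1) + u (i, j - 1))| < K)
    (p q : ZMod N × ZMod N) : u p - u q ≤ 9 / 8 * K * N ^ 2 := by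
  have h₁ := row_oscillation_le u K hu p.1 q.1 p.2
  have h₂ := row_oscillation_le (fun r => u r.swap) K
    (fun i j => by
      have := hu j i
      simp only [Prod.swap_prod_mk]
      convert this using 3
      ring) p.2 q.2 q.1
  simp only [Prod.swap_prod_mk, Prod.mk.eta] at h₁ h₂
  linarith

/-- A mean-zero function on a finite nonempty type is bounded by any bound on its oscillation. -/
theorem abs_le_of_sum_eq_zero_of_sub_le {ι : Type*} [Fintype ι] [Nonempty ι] (u : ι → ℝ) (D : ℝ)
    (hsum : ∑ p, u p = 0) (hD : ∀ p q, u p - u q ≤ D) (p : ι) : |u p| ≤ D := by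
  have hle : ∃ q, u q ≤ 0 := by
    obtain ⟨q, -, hq⟩ := Finset.exists_le_of_sum_le (s := Finset.univ) (f := u) (g := fun _ => 0)
      Finset.univ_nonempty (by simp [hsum])
    exact ⟨q, hq⟩
  have hge : ∃ q, 0 ≤ u q := by
    obtain ⟨q, -, hq⟩ := Finset.exists_le_of_sum_le (s := Finset.univ) (f := fun _ => 0) (g := u)
      Finset.univ_nonempty (by simp [hsum])
    exact ⟨q, hq⟩
  obtain ⟨q, hq⟩ := hle
  obtain ⟨r, hr⟩ := hge
  exact abs_le.2 ⟨by linarith [hD r p], by linarith [hD p q]⟩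

/-- uniform-in-mesh maximum norm estimate for the discrete inverse Laplacian:
there is a constant `C₂ > 0` depending only on `L` such that for every `N`, `h = L/N`,
and mean-zero grid functions `φ, ψ` with `−Δ_h ψ = φ`, one has `‖ψ‖_∞ ≤ C₂ ‖φ‖_∞`. -/
theorem inverse_laplacian_maximum_norm_estimate (L : ℝ) (hL : 0 < L) :
    ∃ C₂ : ℝ, 0 < C₂ ∧
      ∀ (N : ℕ) [NeZero N], ∀ φ ψ : GF N,
        (∑ p : ZMod N × ZMod N, φ p) = 0 →
        (∑ p : ZMod N × ZMod N, ψ p) = 0 →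
        (∀ p, -lap (L / N) ψ p = φ p) →
        (⨆ p : ZMod N × ZMod N, |ψ p|) ≤ C₂ * ⨆ p : ZMod N × ZMod N, |φ p| := by
  refine ⟨9 / 8 * L ^ 2, by positivity, fun N _ φ ψ _ hψ hlap => ciSup_le fun p => ?_⟩
  have hN : (0 : ℝ) < N := by exact_mod_cast NeZero.pos N
  have hh : 0 < (L / N) ^ 2 := by positivity
  have key : ∀ M : ℝ, (⨆ p : ZMod N × ZMod N, |φ p|) < M → |ψ p| ≤ 9 / 8 * L ^ 2 * M := by
    intro M hM
    have hφ (q : ZMod N × ZMod N) : |φ q| < M :=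
      (le_ciSup (f := fun q => |φ q|) (Set.finite_range _).bddAbove q).trans_lt hM
    have hosc := oscillation_le ψ ((L / N) ^ 2 * M) fun i j => by
      have e : 4 * ψ (i, j) - (ψ (i + 1, j) + ψ (i - 1, j) + ψ (i, j + 1) + ψ (i, j - 1))
          = (L / N) ^ 2 * φ (i, j) := by
        rw [← hlap, lap, mul_neg, mul_div_cancel₀ _ hh.ne']
        ring
      rw [e, abs_mul, abs_of_pos hh]
      exact mul_lt_mul_of_pos_left (hφ _) hh
    have := abs_le_of_sum_eq_zero_of_sub_le ψ _ hψ hosc p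
    convert this using 1
    field_simp
  have hC : 0 < 9 / 8 * L ^ 2 := by positivity
  rw [← div_le_iff₀' hC]
  exact le_of_forall_gt_imp_ge_of_dense fun M hM => (div_le_iff₀' hC).2 (key M hM)
end
end

section
/- Fix L > 0, a positive integer N, h = L/N, and parameters ε > 0, β > 0. Let φ, ρ, f_φ, f_ρ be grid functions with 0 < ρ_{i,j} < 1 for all i,j, and set M₁* = max_{i,j} |(f_φ)_{i,j}|, M₂* = max_{i,j} |(f_ρ)_{i,j}|, and |Ω| = (N h)² = L². Then h²·Σ_{i,j} [ (1/(4ε))·(φ_{i,j} − 1/2)⁴ + β·( ρ_{i,j}·ln ρ_{i,j} + (1 − ρ_{i,j})·ln(1 − ρ_{i,j}) ) + φ_{i,j}·(f_φ)_{i,j} + ρ_{i,j}·(f_ρ)_{i,j} ] ≥ (1/(8ε))·h²·Σ_{i,j} (φ_{i,j} − 1/2)⁴ − ( (1/2)(M₁*)² + (1/2)M₁* + (1/2)ε + β·ln 2 + M₂* )·|Ω|. -/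
open scoped BigOperators

noncomputable section

/-- The Flory–Huggins entropy is minimal at `1 / 2`. -/
theorem neg_log_two_le_entropy (s : ℝ) :
    -Real.log 2 ≤ s * Real.log s + (1 - s) * Real.log (1 - s) := by
  have := Real.binEntropy_le_log_two (p := s)
  rw [Real.binEntropy_eq_negMulLog_add_negMulLog_one_sub, Real.negMulLog, Real.negMulLog] at this
  linarith

/-- A quartic well absorbs a bounded linear source term. -/
theorem quartic_add_source_lower_bound {ε M x f : ℝ} (hε : 0 < ε) (hf : |f| ≤ M) :
    (1 / (8 * ε)) * (x - 1 / 2) ^ 4 - ((1 / 2) * M ^ 2 + (1 / 2) * M + (1 / 2) * ε)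
      ≤ (1 / (4 * ε)) * (x - 1 / 2) ^ 4 + x * f := by
  have hsq : 0 ≤ ((x - 1 / 2) ^ 2 - 2 * ε) ^ 2 / (8 * ε) := by positivity
  have hexp : ((x - 1 / 2) ^ 2 - 2 * ε) ^ 2 / (8 * ε) =
      (1 / (4 * ε)) * (x - 1 / 2) ^ 4 - (1 / (8 * ε)) * (x - 1 / 2) ^ 4
        - (1 / 2) * (x - 1 / 2) ^ 2 + (1 / 2) * ε := by
    field_simp
    ring
  have hf_sq : f ^ 2 ≤ M ^ 2 := sq_le_sq' (abs_le.1 hf).1 (abs_le.1 hf).2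
  nlinarith [sq_nonneg (x - 1 / 2 + f), (abs_le.1 hf).1]

/-- A phase variable in `(0, 1)` times a bounded source is bounded below. -/
theorem neg_le_mul_of_abs_le {r f M : ℝ} (hr₀ : 0 ≤ r) (hr₁ : r ≤ 1) (hf : |f| ≤ M) :
    -M ≤ r * f := by
  nlinarith [(abs_le.1 hf).1, abs_nonneg f]

/-- lower bound for the nonlinear and source parts of the discrete
functional `𝒥ⁿ` used in the positivity-preserving analysis. -/
theorem discrete_functional_lower_bound
    (L : ℝ) (hL : 0 < L) (N : ℕ) [NeZero N] (h : ℝ) (hh : h = L / N)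
    (ε β : ℝ) (hε : 0 < ε) (hβ : 0 < β)
    (φ ρ fφ fρ : GF N)
    (hρ : ∀ p, 0 < ρ p ∧ ρ p < 1)
    (M₁ M₂ : ℝ)
    (hM₁ : M₁ = ⨆ p : ZMod N × ZMod N, |fφ p|)
    (hM₂ : M₂ = ⨆ p : ZMod N × ZMod N, |fρ p|) :
    h ^ 2 * ∑ p : ZMod N × ZMod N,
        ((1 / (4 * ε)) * (φ p - 1 / 2) ^ 4
          + β * (ρ p * Real.log (ρ p) + (1 - ρ p) * Real.log (1 - ρ p))
          + φ p * fφ p + ρ p * fρ p)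
      ≥ (1 / (8 * ε)) * (h ^ 2 * ∑ p : ZMod N × ZMod N, (φ p - 1 / 2) ^ 4)
        - ((1 / 2) * M₁ ^ 2 + (1 / 2) * M₁ + (1 / 2) * ε + β * Real.log 2 + M₂) * L ^ 2 := by
  have hN : (N : ℝ) ≠ 0 := Nat.cast_ne_zero.2 (NeZero.ne N)
  have hf₁ (p : ZMod N × ZMod N) : |fφ p| ≤ M₁ :=
    hM₁ ▸ le_ciSup (f := fun q => |fφ q|) (Set.finite_range _).bddAbove p
  have hf₂ (p : ZMod N × ZMod N) : |fρ p| ≤ M₂ :=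
    hM₂ ▸ le_ciSup (f := fun q => |fρ q|) (Set.finite_range _).bddAbove p
  set C := (1 / 2) * M₁ ^ 2 + (1 / 2) * M₁ + (1 / 2) * ε + β * Real.log 2 + M₂ with hC
  have hvol : h ^ 2 * ∑ _p : ZMod N × ZMod N, C = C * L ^ 2 := by
    rw [Finset.sum_const, Finset.card_univ, Fintype.card_prod, ZMod.card, nsmul_eq_mul, hh]
    push_cast
    field_simp
  rw [ge_iff_le, ← hvol, mul_left_comm, ← mul_sub, Finset.mul_sum, ← Finset.sum_sub_distrib]
  gcongr with p
  have hφ := quartic_add_source_lower_bound (x := φ p) hε (hf₁ p)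
  have hent := mul_le_mul_of_nonneg_left (neg_log_two_le_entropy (ρ p)) hβ.le
  have hsrc := neg_le_mul_of_abs_le (hρ p).1.le (hρ p).2.le (hf₂ p)
  linarith
end
end

section
/- Fix L > 0, a positive integer N, h = L/N. Let 𝒟ˣ, 𝒟ʸ : (ZMod N) × (ZMod N) → ℝ be grid functions with 𝒟ˣ_{i,j} > 0 and 𝒟ʸ_{i,j} > 0 for all i,j, and define the operator L_𝒟 on grid functions by (L_𝒟 ψ)_{i,j} = −(1/h)·[ 𝒟ˣ_{i,j}(D_x ψ)_{i,j} − 𝒟ˣ_{i−1,j}(D_x ψ)_{i−1,j} + 𝒟ʸ_{i,j}(D_y ψ)_{i,j} − 𝒟ʸ_{i,j−1}(D_y ψ)_{i,j−1} ]. Then for every grid function φ there exists a unique grid function ψ with mean zero ((1/N²)·Σ_{i,j} ψ_{i,j} = 0) such that L_𝒟 ψ = φ − φ̄, where φ̄ = (1/N²)·Σ_{i,j} φ_{i,j}. -/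
open scoped BigOperators

noncomputable section

/-- The variable-coefficient discrete elliptic operator
`(L_𝒟 ψ)_{i,j} = −(1/h)[𝒟ˣ_{i,j}(D_x ψ)_{i,j} − 𝒟ˣ_{i−1,j}(D_x ψ)_{i−1,j}
+ 𝒟ʸ_{i,j}(D_y ψ)_{i,j} − 𝒟ʸ_{i,j−1}(D_y ψ)_{i,j−1}]`. -/
def LD {N : ℕ} (h : ℝ) (Dxc Dyc : GF N) (ψ : GF N) : GF N := fun p =>
  -(1 / h) * (Dxc p * Dx h ψ p - Dxc (p.1 - 1, p.2) * Dx h ψ (p.1 - 1, p.2)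
    + Dyc p * Dy h ψ p - Dyc (p.1, p.2 - 1) * Dy h ψ (p.1, p.2 - 1))

/-- The operator `LD` as a linear map. -/
def LDLin {N : ℕ} (h : ℝ) (Dxc Dyc : GF N) : GF N →ₗ[ℝ] GF N where
  toFun := LD h Dxc Dyc
  map_add' u v := by
    funext p
    simp only [LD, Dx, Dy, Pi.add_apply]
    ring
  map_smul' c u := by
    funext p
    simp only [LD, Dx, Dy, Pi.smul_apply, smul_eq_mul, RingHom.id_apply]
    ring

theorem sum_comp_fst_sub_one {N : ℕ} [NeZero N] (u : GF N) :
    ∑ p : ZMod N × ZMod N, u (p.1 - 1, p.2) = ∑ p, u p :=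
  ((Equiv.subRight (1 : ZMod N)).prodCongr (Equiv.refl (ZMod N))).sum_comp u

theorem sum_comp_snd_sub_one {N : ℕ} [NeZero N] (u : GF N) :
    ∑ p : ZMod N × ZMod N, u (p.1, p.2 - 1) = ∑ p, u p :=
  ((Equiv.refl (ZMod N)).prodCongr (Equiv.subRight (1 : ZMod N))).sum_comp u

/-- Summation by parts for `LD`. -/
theorem sum_mul_LD {N : ℕ} [NeZero N] (h : ℝ) (Dxc Dyc χ ψ : GF N) :
    ∑ p, χ p * LD h Dxc Dyc ψ p =
      ∑ p, (Dxc p * (Dx h χ p * Dx h ψ p) + Dyc p * (Dy h χ p * Dy h ψ p)) := by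
  have hx := sum_comp_fst_sub_one
    (fun p : ZMod N × ZMod N => 1 / h * (χ (p.1 + 1, p.2) * (Dxc p * Dx h ψ p)))
  have hy := sum_comp_snd_sub_one
    (fun p : ZMod N × ZMod N => 1 / h * (χ (p.1, p.2 + 1) * (Dyc p * Dy h ψ p)))
  simp only [sub_add_cancel] at hx hy
  rw [← sub_eq_zero] at hx hy ⊢
  rw [← Finset.sum_sub_distrib] at hx hy ⊢
  rw [← add_zero (0 : ℝ)]
  nth_rewrite 1 [← hx]
  rw [← hy, ← Finset.sum_add_distrib]
  refine Finset.sum_congr rfl fun p _ => ?_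
  simp only [LD, show Dx h χ p = (χ (p.1 + 1, p.2) - χ p) / h from rfl,
    show Dy h χ p = (χ (p.1, p.2 + 1) - χ p) / h from rfl]
  ring

theorem sum_LD {N : ℕ} [NeZero N] (h : ℝ) (Dxc Dyc ψ : GF N) :
    ∑ p, LD h Dxc Dyc ψ p = 0 := by
  simpa [Dx, Dy] using sum_mul_LD h Dxc Dyc 1 ψ

theorem ZMod.eq_apply_zero_of_add_one {N : ℕ} [NeZero N] {α : Type*} {f : ZMod N → α}
    (hf : ∀ i, f (i + 1) = f i) (i : ZMod N) : f i = f 0 := by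
  have key (n : ℕ) : f n = f 0 := by
    induction n with
    | zero => simp
    | succ n ih => rw [Nat.cast_succ, hf, ih]
  simpa using key i.val

/-- The kernel of `LD` consists of constant grid functions. -/
theorem eq_const_of_LD_eq_zero {N : ℕ} [NeZero N] {h : ℝ} (hh : h ≠ 0) {Dxc Dyc ψ : GF N}
    (hDx : ∀ p, 0 < Dxc p) (hDy : ∀ p, 0 < Dyc p) (hψ : ∀ p, LD h Dxc Dyc ψ p = 0)
    (p : ZMod N × ZMod N) : ψ p = ψ 0 := by
  have energy := sum_mul_LD h Dxc Dyc ψ ψ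
  simp only [hψ, mul_zero, Finset.sum_const_zero] at energy
  have hx0 (q) : 0 ≤ Dxc q * (Dx h ψ q * Dx h ψ q) :=
    mul_nonneg (hDx q).le (mul_self_nonneg _)
  have hy0 (q) : 0 ≤ Dyc q * (Dy h ψ q * Dy h ψ q) :=
    mul_nonneg (hDy q).le (mul_self_nonneg _)
  have hzero (q) := (Finset.sum_eq_zero_iff_of_nonneg
    fun q _ => add_nonneg (hx0 q) (hy0 q)).1 energy.symm q (Finset.mem_univ q)
  have stepx (q : ZMod N × ZMod N) : ψ (q.1 + 1, q.2) = ψ q := by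
    have := ((add_eq_zero_iff_of_nonneg (hx0 q) (hy0 q)).1 (hzero q)).1
    simpa [(hDx q).ne', Dx, hh, sub_eq_zero] using this
  have stepy (q : ZMod N × ZMod N) : ψ (q.1, q.2 + 1) = ψ q := by
    have := ((add_eq_zero_iff_of_nonneg (hx0 q) (hy0 q)).1 (hzero q)).2
    simpa [(hDy q).ne', Dy, hh, sub_eq_zero] using this
  calc ψ p = ψ (0, p.2) :=
        ZMod.eq_apply_zero_of_add_one (f := fun i => ψ (i, p.2)) (fun i => stepx (i, p.2)) p.1
    _ = ψ 0 :=
        ZMod.eq_apply_zero_of_add_one (f := fun j => ψ (0, j)) (fun j => stepy (0, j)) p.2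

/-- A mean-zero grid function in the kernel of `LD` vanishes. -/
theorem eq_zero_of_LD_eq_zero {N : ℕ} [NeZero N] {h : ℝ} (hh : h ≠ 0) {Dxc Dyc ψ : GF N}
    (hDx : ∀ p, 0 < Dxc p) (hDy : ∀ p, 0 < Dyc p) (hψ : ∀ p, LD h Dxc Dyc ψ p = 0)
    (hsum : ∑ p, ψ p = 0) : ψ = 0 := by
  have hconst := eq_const_of_LD_eq_zero hh hDx hDy hψ
  have h0 : ψ 0 = 0 := by
    rw [Finset.sum_congr rfl fun p _ => hconst p] at hsum
    simpa [NeZero.ne N] using hsum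
  funext p
  rw [hconst p, h0, Pi.zero_apply]

/-- The perturbation of `LD` by the total sum, which is invertible. -/
def LDAddSum {N : ℕ} [NeZero N] (h : ℝ) (Dxc Dyc : GF N) : GF N →ₗ[ℝ] GF N :=
  LDLin h Dxc Dyc + LinearMap.pi fun _ => ∑ q, LinearMap.proj q

theorem LDAddSum_apply {N : ℕ} [NeZero N] (h : ℝ) (Dxc Dyc ψ : GF N) (p : ZMod N × ZMod N) :
    LDAddSum h Dxc Dyc ψ p = LD h Dxc Dyc ψ p + ∑ q, ψ q := by
  simp [LDAddSum, LDLin]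

theorem sum_eq_zero_of_sum_LDAddSum_eq_zero {N : ℕ} [NeZero N] {h : ℝ}
    {Dxc Dyc ψ : GF N} (hψ : ∑ p, LDAddSum h Dxc Dyc ψ p = 0) : ∑ p, ψ p = 0 := by
  simpa [LDAddSum_apply, Finset.sum_add_distrib, sum_LD, NeZero.ne N] using hψ

theorem LDAddSum_injective {N : ℕ} [NeZero N] {h : ℝ} (hh : h ≠ 0) {Dxc Dyc : GF N}
    (hDx : ∀ p, 0 < Dxc p) (hDy : ∀ p, 0 < Dyc p) :
    Function.Injective (LDAddSum h Dxc Dyc) := by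
  refine (injective_iff_map_eq_zero _).2 fun ψ hψ => ?_
  have hsum : ∑ p, ψ p = 0 := sum_eq_zero_of_sum_LDAddSum_eq_zero (h := h) (Dxc := Dxc) (Dyc := Dyc)
    (by rw [hψ]; simp)
  refine eq_zero_of_LD_eq_zero hh hDx hDy (fun p => ?_) hsum
  simpa [LDAddSum_apply, hsum] using congrFun hψ p

/-- unique solvability of the discrete variable-coefficient elliptic
problem: for positive edge coefficients `𝒟ˣ, 𝒟ʸ` and any grid function `φ`, there is a
unique mean-zero grid function `ψ` with `L_𝒟 ψ = φ − φ̄`. -/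
theorem LD_unique_solvability
    (L : ℝ) (hL : 0 < L) (N : ℕ) [NeZero N] (h : ℝ) (hh : h = L / N)
    (Dxc Dyc : GF N) (hDx : ∀ p, 0 < Dxc p) (hDy : ∀ p, 0 < Dyc p)
    (φ : GF N) :
    ∃! ψ : GF N,
      (1 / (N : ℝ) ^ 2) * (∑ p : ZMod N × ZMod N, ψ p) = 0
      ∧ ∀ p, LD h Dxc Dyc ψ p
          = φ p - (1 / (N : ℝ) ^ 2) * ∑ q : ZMod N × ZMod N, φ q := by
  have hN : (N : ℝ) ≠ 0 := Nat.cast_ne_zero.2 (NeZero.ne N)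
  have hh0 : h ≠ 0 := hh ▸ div_ne_zero hL.ne' hN
  have hinj := LDAddSum_injective hh0 hDx hDy
  obtain ⟨ψ, hψ⟩ := LinearMap.injective_iff_surjective.1 hinj
    (fun p => φ p - (1 / (N : ℝ) ^ 2) * ∑ q, φ q)
  have hsum : ∑ p, ψ p = 0 := by
    refine sum_eq_zero_of_sum_LDAddSum_eq_zero (h := h) (Dxc := Dxc) (Dyc := Dyc) ?_
    rw [hψ, Finset.sum_sub_distrib, Finset.sum_const, Finset.card_univ, Fintype.card_prod,
      ZMod.card, nsmul_eq_mul, Nat.cast_mul]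
    field_simp
    ring
  refine ⟨ψ, ⟨by rw [hsum, mul_zero], fun p => ?_⟩, fun χ ⟨hχ, hLD⟩ => hinj ?_⟩
  · rw [← congrFun hψ p, LDAddSum_apply, hsum, add_zero]
  · have hχ0 : ∑ p, χ p = 0 := by simpa [hN] using hχ
    rw [hψ]
    funext p
    rw [LDAddSum_apply, hLD, hχ0, add_zero]
end
end

section
/- Let E be a nontrivial finite-dimensional real inner product space and let A : E → E be a self-adjoint linear operator that is positive definite (⟪A x, x⟫ > 0 for all x ≠ 0), so that A is invertible. Then for every x ∈ E: ⟪x, A x⟫ ≤ (⟪x, A⁻¹ x⟫)^{1/3} · ‖A x‖^{4/3}. -/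
open scoped RealInnerProductSpace

/-- Cauchy–Schwarz inequality for the quadratic form of a symmetric positive definite operator. -/
lemma inner_map_sq_le_of_symm_of_pos
    {E : Type*} [NormedAddCommGroup E] [InnerProductSpace ℝ E] (A : E →ₗ[ℝ] E)
    (hsym : ∀ x y : E, ⟪A x, y⟫ = ⟪x, A y⟫) (hpos : ∀ x : E, x ≠ 0 → 0 < ⟪A x, x⟫) (x y : E) :
    ⟪A y, x⟫ ^ 2 ≤ ⟪A y, y⟫ * ⟪A x, x⟫ := by
  rcases eq_or_ne x 0 with rfl | hx
  · simp
  have hc := hpos x hx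
  have hnonneg : ∀ z : E, 0 ≤ ⟪A z, z⟫ := fun z ↦ by
    rcases eq_or_ne z 0 with rfl | hz
    · simp
    · exact (hpos z hz).le
  have h := hnonneg (⟪A x, x⟫ • y - ⟪A y, x⟫ • x)
  have hxy : ⟪A x, y⟫ = ⟪A y, x⟫ := by rw [hsym, real_inner_comm]
  simp only [map_sub, map_smul, inner_sub_left, inner_sub_right, real_inner_smul_left,
    real_inner_smul_right, hxy] at h
  have h' : 0 ≤ ⟪A x, x⟫ * (⟪A y, y⟫ * ⟪A x, x⟫ - ⟪A y, x⟫ ^ 2) := by linarith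
  linarith [nonneg_of_mul_nonneg_right h' hc]

/-- An injective endomorphism of a finite-dimensional space is right-inverted by
`Ring.inverse`. -/
lemma LinearMap.map_ringInverse_apply_of_injective
    {K V : Type*} [Field K] [AddCommGroup V] [Module K V] [FiniteDimensional K V] {A : V →ₗ[K] V}
    (hA : Function.Injective A) (x : V) : A (Ring.inverse A x) = x := by
  have hu : IsUnit A := (LinearMap.isUnit_iff_ker_eq_bot A).2 (LinearMap.ker_eq_bot.2 hA)
  exact LinearMap.congr_fun (Ring.mul_inverse_cancel A hu) x

/-- interpolation inequality for a self-adjoint positive definite operator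
`A` on a nontrivial finite-dimensional real inner product space (so `A` is invertible):
`⟪x, A x⟫ ≤ ⟪x, A⁻¹ x⟫^{1/3} · ‖A x‖^{4/3}`. Here `A⁻¹ = Ring.inverse A` in the
endomorphism ring. -/
theorem selfadjoint_interpolation_inequality
    {E : Type*} [NormedAddCommGroup E] [InnerProductSpace ℝ E]
    [FiniteDimensional ℝ E] [Nontrivial E]
    (A : E →ₗ[ℝ] E)
    (hsym : ∀ x y : E, ⟪A x, y⟫ = ⟪x, A y⟫)
    (hpos : ∀ x : E, x ≠ 0 → 0 < ⟪A x, x⟫)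
    (x : E) :
    ⟪x, A x⟫ ≤ (⟪x, (Ring.inverse A) x⟫) ^ ((1 : ℝ) / 3) * ‖A x‖ ^ ((4 : ℝ) / 3) := by
  rcases eq_or_ne x 0 with rfl | hx
  · simp
  have hinj : Function.Injective A := by
    refine (injective_iff_map_eq_zero A).2 fun z hz ↦ ?_
    by_contra hne
    simpa [hz] using hpos z hne
  set y := Ring.inverse A x
  have hy : A y = x := LinearMap.map_ringInverse_apply_of_injective hinj x
  have hc : 0 < ⟪x, A x⟫ := hsym x x ▸ hpos x hx
  have hb := inner_map_sq_le_of_symm_of_pos A hsym hpos x y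
  rw [hy, hsym x x, real_inner_self_eq_norm_sq] at hb
  have ha : 0 ≤ ⟪x, y⟫ := nonneg_of_mul_nonneg_left ((sq_nonneg _).trans hb) hc
  have hd : ⟪x, A x⟫ ≤ ‖x‖ * ‖A x‖ := real_inner_le_norm x (A x)
  have hcube : ⟪x, A x⟫ ^ 3 ≤ ⟪x, y⟫ * ‖A x‖ ^ 4 := by
    refine le_of_mul_le_mul_right ?_ hc
    calc ⟪x, A x⟫ ^ 3 * ⟪x, A x⟫ = ⟪x, A x⟫ ^ 4 := by ring
      _ ≤ (‖x‖ * ‖A x‖) ^ 4 := by gcongr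
      _ = (‖x‖ ^ 2) ^ 2 * ‖A x‖ ^ 4 := by ring
      _ ≤ (⟪x, y⟫ * ⟪x, A x⟫) * ‖A x‖ ^ 4 := by gcongr
      _ = ⟪x, y⟫ * ‖A x‖ ^ 4 * ⟪x, A x⟫ := by ring
  calc ⟪x, A x⟫ = (⟪x, A x⟫ ^ 3) ^ ((1 : ℝ) / 3) := by
        rw [← Real.rpow_natCast, ← Real.rpow_mul hc.le]; norm_num
    _ ≤ (⟪x, y⟫ * ‖A x‖ ^ 4) ^ ((1 : ℝ) / 3) := by gcongr
    _ = ⟪x, y⟫ ^ ((1 : ℝ) / 3) * ‖A x‖ ^ ((4 : ℝ) / 3) := by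
        rw [Real.mul_rpow ha (by positivity), ← Real.rpow_natCast,
          ← Real.rpow_mul (norm_nonneg _)]
        norm_num
end
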